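/- arXiv:1412.5781 — 2 statements merged into one kernel-verified Lean document; each statement's English description precedes it below -/
import Mathlib

section
/- For every subset D of U^{|z|} and every small parameter set A ⊆ U, there exists a subset C of U^{|z|} such that C is saturated (i.e., the expansion ⟨U,C⟩ is a saturated structure) and ⟨U,C⟩ ≡_A ⟨U,D⟩. Moreover, if D and C are both saturated and ⟨U,C⟩ ≡_A ⟨U,D⟩, then there is an automorphism f of U fixing A pointwise with f[D] = C. -/
namespace Paper

open FirstOrder Language Cardinal Set

universe u

variable (L : FirstOrder.Language.{u, u}) (U : Type u) [iS : L.Structure U]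

/-- A language consisting of a single `n`-ary relation symbol. -/
def predLang (n : ℕ) : FirstOrder.Language.{u, u} where
  Functions := fun _ => PEmpty
  Relations := fun m => ULift (PLift (m = n))

/-- The language `L` together with one new `n`-ary relation symbol. -/
def expLang (n : ℕ) : FirstOrder.Language.{u, u} := L.sum (predLang n)

/-- The expansion `⟨U, D⟩` of `U` by a predicate for `D ⊆ U^n`. -/
def expStr {n : ℕ} (D : Set (Fin n → U)) : (expLang L n).Structure U where
  funMap := fun {_} f x =>
    match f with
    | Sum.inl f => Structure.funMap f x
    | Sum.inr f => f.elim
  RelMap := fun {_} r x =>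
    match r with
    | Sum.inl r => Structure.RelMap r x
    | Sum.inr h => (x ∘ Fin.cast h.down.down.symm) ∈ D

/-- Add the elements of `A : Set U` as constants to an arbitrary structure on `U`. -/
def addConsts {L' : FirstOrder.Language.{u, u}} (S : L'.Structure U) (A : Set U) :
    (L'[[↥A]]).Structure U :=
  letI := S
  letI : (constantsOn ↥A).Structure U := constantsOn.structure Subtype.val
  Language.sumStructure _ _ _

/-- Add all elements of `U` as constants to an arbitrary structure on `U`. -/
def addAllConsts {L' : FirstOrder.Language.{u, u}} (S : L'.Structure U) :
    (L'[[U]]).Structure U :=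
  letI := S
  letI : (constantsOn U).Structure U := constantsOn.structure id
  Language.sumStructure _ _ _

/-- Realization of a formula with respect to an explicitly given structure. -/
def FRealize {L' : FirstOrder.Language.{u, u}} (S : L'.Structure U) {α : Type*}
    (φ : L'.Formula α) (v : α → U) : Prop :=
  @Formula.Realize L' U S α φ v

/-- Realization of a sentence with respect to an explicitly given structure. -/
def SentRealize {L' : FirstOrder.Language.{u, u}} (S : L'.Structure U) (φ : L'.Sentence) : Prop :=
  @Sentence.Realize L' U S φ

/-- A structure on `U` is saturated if every type over a parameter set of cardinality `< #U`
which is finitely realized is realized. -/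
def IsSatStr {L' : FirstOrder.Language.{u, u}} (S : L'.Structure U) : Prop :=
  ∀ A : Set U, #A < #U → ∀ (m : ℕ) (p : Set ((L'[[↥A]]).Formula (Fin m))),
    (∀ s : Finset ((L'[[↥A]]).Formula (Fin m)), ↑s ⊆ p →
      ∃ b : Fin m → U, ∀ φ ∈ s, FRealize U (addConsts U S A) φ b) →
    ∃ b : Fin m → U, ∀ φ ∈ p, FRealize U (addConsts U S A) φ b

/-- `D ⊆ U^n` is saturated if the expansion `⟨U, D⟩` is a saturated structure. -/
def SatSet {n : ℕ} (D : Set (Fin n → U)) : Prop :=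
  IsSatStr U (expStr L U D)

/-- `⟨U,C⟩ ≡_A ⟨U,D⟩` : the two expansions satisfy the same sentences with parameters in `A`. -/
def EqvOver {n : ℕ} (A : Set U) (C D : Set (Fin n → U)) : Prop :=
  ∀ φ : ((expLang L n)[[↥A]]).Sentence,
    SentRealize U (addConsts U (expStr L U C) A) φ ↔
      SentRealize U (addConsts U (expStr L U D) A) φ

/-- `e(D/A)`, the class of all `C` with `⟨U,C⟩ ≡_A ⟨U,D⟩`. -/
def eSet {n : ℕ} (A : Set U) (D : Set (Fin n → U)) : Set (Set (Fin n → U)) :=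
  {C | EqvOver L U A C D}

/-- The group `Aut(U/A)` of automorphisms of `U` fixing `A` pointwise (as a set). -/
def AutFix (A : Set U) : Set (U ≃[L] U) :=
  {f | ∀ a ∈ A, f a = a}

/-- The image of a set of tuples under an automorphism. -/
def imgSet {n : ℕ} (f : U ≃[L] U) (D : Set (Fin n → U)) : Set (Fin n → U) :=
  (fun b => ⇑f ∘ b) '' D

/-- The orbit `o(D/A)` of `D` under `Aut(U/A)`. -/
def oSet {n : ℕ} (A : Set U) (D : Set (Fin n → U)) : Set (Set (Fin n → U)) :=
  {C | ∃ f ∈ AutFix L U A, imgSet L U f D = C}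

/-- The orbit `o(b/A)` of a tuple `b` under `Aut(U/A)`. -/
def oTuple {n : ℕ} (A : Set U) (b : Fin n → U) : Set (Fin n → U) :=
  {c | ∃ f ∈ AutFix L U A, ⇑f ∘ b = c}

/-- A family of sets shatters `B` if every subset of `B` is the trace of a member. -/
def Shatters {α : Type*} (u : Set (Set α)) (B : Set α) : Prop :=
  ∀ H ⊆ B, ∃ D ∈ u, D ∩ B = H

/-- A family of sets has finite VC dimension if for some `N` it shatters no `N`-element set. -/
def FiniteVC {α : Type*} (u : Set (Set α)) : Prop :=
  ∃ N : ℕ, ∀ B : Finset α, B.card = N → ¬Shatters u ↑B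

/-- `B^{|z|}`, the set of tuples with coordinates in `B`. -/
def tuplesIn {n : ℕ} (B : Set U) : Set (Fin n → U) :=
  {a | ∀ i, a i ∈ B}

/-- `φ(b, U)`, the set defined by `φ(x,z)` with `x ↦ b`. -/
def phiSet {m n : ℕ} (φ : L.Formula (Fin m ⊕ Fin n)) (b : Fin m → U) :
    Set (Fin n → U) :=
  {a | φ.Realize (Sum.elim b a)}

/-- `D` is approximable by `φ(x,z)` : every finite trace of `D` is the trace of
some instance `φ(b,U)`. -/
def ApproxBy {n : ℕ} (D : Set (Fin n → U)) {m : ℕ} (φ : L.Formula (Fin m ⊕ Fin n)) : Prop :=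
  ∀ B : Finset U, ∃ b : Fin m → U,
    phiSet L U φ b ∩ tuplesIn U ↑B = D ∩ tuplesIn U ↑B

/-- `D` is approximable from below by `φ(x,z)`. -/
def ApproxBelowBy {n : ℕ} (D : Set (Fin n → U)) {m : ℕ}
    (φ : L.Formula (Fin m ⊕ Fin n)) : Prop :=
  ∀ B : Finset U, ∃ b : Fin m → U,
    phiSet L U φ b ∩ tuplesIn U ↑B = D ∩ tuplesIn U ↑B ∧ phiSet L U φ b ⊆ D

/-- `D` is approximable from above by `φ(x,z)`. -/
def ApproxAboveBy {n : ℕ} (D : Set (Fin n → U)) {m : ℕ}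
    (φ : L.Formula (Fin m ⊕ Fin n)) : Prop :=
  ∀ B : Finset U, ∃ b : Fin m → U,
    phiSet L U φ b ∩ tuplesIn U ↑B = D ∩ tuplesIn U ↑B ∧ D ⊆ phiSet L U φ b

def Approximable {n : ℕ} (D : Set (Fin n → U)) : Prop :=
  ∃ (m : ℕ) (φ : L.Formula (Fin m ⊕ Fin n)), ApproxBy L U D φ

def ApproxBelow {n : ℕ} (D : Set (Fin n → U)) : Prop :=
  ∃ (m : ℕ) (φ : L.Formula (Fin m ⊕ Fin n)), ApproxBelowBy L U D φ

def ApproxAbove {n : ℕ} (D : Set (Fin n → U)) : Prop :=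
  ∃ (m : ℕ) (φ : L.Formula (Fin m ⊕ Fin n)), ApproxAboveBy L U D φ

/-- The formula `φ(x, a)` (an `L(U)`-formula in the variables `x`), obtained by
substituting the tuple `a` for the variables `z` in `φ(x,z)`. -/
def instFormula {m n : ℕ} (φ : L.Formula (Fin m ⊕ Fin n)) (a : Fin n → U) :
    (L[[U]]).Formula (Fin m) :=
  ((L.lhomWithConstants U).onFormula φ).subst
    (Sum.elim (fun i => Term.var i) (fun j => (L.con (a j)).term))

/-- A (complete) global type in the variables `x = (x_0, ..., x_{m-1})` : a maximal
finitely realized set of `L(U)`-formulas. -/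
def IsGlobalType {m : ℕ} (p : Set ((L[[U]]).Formula (Fin m))) : Prop :=
  (∀ s : Finset ((L[[U]]).Formula (Fin m)), ↑s ⊆ p →
    ∃ b : Fin m → U, ∀ φ ∈ s, FRealize U (addAllConsts U iS) φ b) ∧
  ∀ φ : (L[[U]]).Formula (Fin m), φ ∈ p ↔ φ.not ∉ p

/-- `D` is externally definable: `D = {a : φ(x,a) ∈ p}` for some global type `p` and
formula `φ(x,z)`. -/
def ExtDefinable {n : ℕ} (D : Set (Fin n → U)) : Prop :=
  ∃ (m : ℕ) (φ : L.Formula (Fin m ⊕ Fin n)) (p : Set ((L[[U]]).Formula (Fin m))),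
    IsGlobalType L U p ∧ D = {a | instFormula L U φ a ∈ p}

/-- A sequence of `n`-tuples is indiscernible with respect to the formulas of a
structure `S` on `U`. -/
def IndiscIn {L' : FirstOrder.Language.{u, u}} (S : L'.Structure U) {n : ℕ} {I : Type*} [LinearOrder I]
    (a : I → Fin n → U) : Prop :=
  ∀ (k : ℕ) (i j : Fin k → I), StrictMono i → StrictMono j →
    ∀ φ : L'.Formula (Fin k × Fin n),
      FRealize U S φ (fun q => a (i q.1) q.2) ↔ FRealize U S φ (fun q => a (j q.1) q.2)

/-- An `A`-indiscernible sequence of `n`-tuples. -/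
def IndiscOver {n : ℕ} (A : Set U) {I : Type*} [LinearOrder I] (a : I → Fin n → U) : Prop :=
  IndiscIn U (addConsts U iS A) a


/-- `D` is Lascar invariant over `A` : `D` is invariant over every small model containing `A`. -/
def LascarInv {n : ℕ} (A : Set U) (D : Set (Fin n → U)) : Prop :=
  ∀ M : L.ElementarySubstructure U, A ⊆ (M : L.Substructure U) →
    #((M : L.Substructure U) : Set U) < #U →
    ∀ f ∈ AutFix L U ((M : L.Substructure U) : Set U), imgSet L U f D = D

/-- The cardinality of the set `L(A)` of formulas with parameters in `A`. -/
def formulaCard (A : Set U) : Cardinal.{u} :=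
  #(Σ k : ℕ, (L[[↥A]]).Formula (Fin k))

/-- `u` locally covers `B` (relative to the cardinal `κ`). -/
def LocallyCovers {α : Type u} (κ : Cardinal.{u}) (u : Set (Set α)) (B : Set α) : Prop :=
  ∀ K : Set α, K ⊆ B → #K = κ → ∀ k : ℕ, ∃ D ∈ u, (k : Cardinal.{u}) ≤ #(↥(K ∩ D))

/-- `φ(x, b)` divides over `A` : for some infinite `K ⊆ o(b/A)` and some `k`,
`{φ(x,c) : c ∈ K}` is `k`-inconsistent. -/
def Divides {m n : ℕ} (φ : L.Formula (Fin m ⊕ Fin n)) (b : Fin n → U) (A : Set U) : Prop :=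
  ∃ K : Set (Fin n → U), K ⊆ oTuple L U A b ∧ K.Infinite ∧
    ∃ k : ℕ, ∀ s : Finset (Fin n → U), ↑s ⊆ K → s.card = k →
      ¬∃ x : Fin m → U, ∀ c ∈ s, φ.Realize (Sum.elim x c)

/-- `C` is pseudo-invariant over `A` : `e(C)` locally covers `o(b/A)` for every `b ∈ C`. -/
def PseudoInv {k : ℕ} (A : Set U) (C : Set (Fin k → U)) : Prop :=
  ∀ b ∈ C, LocallyCovers (#U) (eSet L U (∅ : Set U) C) (oTuple L U A b)

/-- A family `u` of subsets of `U^n` is closed: it is cut out by a set of sentences with a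
second-order variable, i.e. sentences of the language expanded by a predicate. -/
def ClosedFam {n : ℕ} (u : Set (Set (Fin n → U))) : Prop :=
  ∃ p : Set ((expLang L n).Sentence),
    u = {D | ∀ φ ∈ p, SentRealize U (expStr L U D) φ}

/-- `κ` is a Ramsey cardinal : every `2`-coloring of the finite subsets of a set of size `κ`
has a homogeneous set of size `κ`. -/
def IsRamseyCard (κ : Cardinal.{u}) : Prop :=
  ∀ (X : Type u), #X = κ → ∀ c : Finset X → Bool,
    ∃ H : Set X, #H = κ ∧
      ∀ s t : Finset X, ↑s ⊆ H → ↑t ⊆ H → s.card = t.card → c s = c t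

/-- The formula `φ(x,z)` is NIP: the family of its instances `φ(a,U)` has finite
VC dimension. -/
def FormulaNIP {m n : ℕ} (φ : L.Formula (Fin m ⊕ Fin n)) : Prop :=
  FiniteVC {E : Set (Fin n → U) | ∃ b : Fin m → U, E = phiSet L U φ b}

/-- The theory of `U` is NIP: every formula is NIP. -/
def TheoryNIP : Prop :=
  ∀ (m n : ℕ) (φ : L.Formula (Fin m ⊕ Fin n)), FormulaNIP L U φ

/-- A global type `p(z)` is invariant over `A` : each of the sets `D_{p,φ}` is fixed
(setwise) by every automorphism fixing `A` pointwise. -/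
def GlobalTypeInv {n : ℕ} (A : Set U) (p : Set ((L[[U]]).Formula (Fin n))) : Prop :=
  ∀ (k : ℕ) (φ : L.Formula (Fin n ⊕ Fin k)) (f : U ≃[L] U), f ∈ AutFix L U A →
    imgSet L U f {a | instFormula L U φ a ∈ p} = {a | instFormula L U φ a ∈ p}

/-- `M` (a subset of `U`) is `L(A;C)`-saturated : every finitely realized type `p(x) ⊆ L(A;C)`
is realized by a tuple from `M`. -/
def LACSat {n : ℕ} (C : Set (Fin n → U)) (A : Set U) (M : Set U) : Prop :=
  ∀ (m : ℕ) (p : Set (((expLang L n)[[↥A]]).Formula (Fin m))),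
    (∀ s : Finset (((expLang L n)[[↥A]]).Formula (Fin m)), ↑s ⊆ p →
      ∃ b : Fin m → U, ∀ φ ∈ s, FRealize U (addConsts U (expStr L U C) A) φ b) →
    ∃ b : Fin m → U, (∀ i, b i ∈ M) ∧
      ∀ φ ∈ p, FRealize U (addConsts U (expStr L U C) A) φ b

/-- The inclusion of languages `L(M) → L(U)` for `M : Set U`. -/
def liftConsts (M : Set U) : (L[[↥M]]) →ᴸ (L[[U]]) :=
  LHom.sumMap (LHom.id L) (LHom.constantsOnMap Subtype.val)

variable {L' : FirstOrder.Language.{u, u}}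

/-- An increasing greedy union of sets `p i`, skipping those that break a condition of finite
character. -/
theorem exists_greedy {I X : Type u} [LinearOrder I] [WellFoundedLT I] (R : Finset X → Prop)
    (hR : R ∅) (p : I → Set X) :
    ∃ S : I → Set X, (∀ i, S i ⊆ p i) ∧
      (∀ s : Finset X, ↑s ⊆ ⋃ i, S i → R s) ∧
      ∀ i, (∀ s : Finset X, ↑s ⊆ (⋃ j : Iio i, S j) ∪ p i → R s) → S i = p i := by
  classical
  let F : ∀ i : I, (∀ j, j < i → Set X) → Set X := fun i S =>
    if ∀ s : Finset X, ↑s ⊆ (⋃ j : Iio i, S j j.2) ∪ p i → R s then p i else ∅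
  let S : I → Set X := wellFounded_lt.fix F
  have hS : ∀ i, S i =
      if ∀ s : Finset X, ↑s ⊆ (⋃ j : Iio i, S j) ∪ p i → R s then p i else ∅ :=
    fun i => wellFounded_lt.fix_eq F i
  have hmax : ∀ (J : Set I), (∀ i ∈ J, ∀ s : Finset X, ↑s ⊆ ⋃ j : Iic i, S j → R s) →
      ∀ s : Finset X, ↑s ⊆ ⋃ j : J, S j → R s := by
    intro J hJ s hs
    rcases s.eq_empty_or_nonempty with rfl | hne
    · exact hR
    have hs' : ∀ x : s, ∃ j : J, (x : X) ∈ S j := fun x => by simpa using hs x.2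
    choose g hg using hs'
    have : Nonempty s := hne.to_subtype
    obtain ⟨m, hm⟩ := Finite.exists_max g
    refine hJ (g m) (g m).2 s fun x hx => ?_
    exact mem_iUnion.2 ⟨⟨g ⟨x, hx⟩, hm ⟨x, hx⟩⟩, hg ⟨x, hx⟩⟩
  have hlt : ∀ i : I, ∀ s : Finset X, ↑s ⊆ ⋃ j : Iic i, S j → R s := by
    intro i
    induction i using WellFoundedLT.induction with
    | ind i ih =>
      intro s hs
      have hsplit : ∀ x ∈ s, x ∈ (⋃ j : Iio i, S j) ∪ S i := by
        intro x hx
        obtain ⟨⟨j, hj⟩, hxj⟩ := mem_iUnion.1 (hs hx)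
        rcases (show j ≤ i from hj).lt_or_eq with h | rfl
        · exact Or.inl (mem_iUnion.2 ⟨⟨j, h⟩, hxj⟩)
        · exact Or.inr hxj
      rw [hS i] at hsplit
      split_ifs at hsplit with h
      · exact h s hsplit
      · exact hmax (Iio i) (fun j hj => ih j hj) s (fun x hx => by simpa using hsplit x hx)
  refine ⟨S, fun i => ?_, fun s hs => ?_, fun i hi => ?_⟩
  · rw [hS i]; split_ifs <;> simp
  · exact hmax univ (fun i _ => hlt i) s (by simpa using hs)
  · rw [hS i, if_pos hi]

/-- A finite conjunction of formulas. -/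
noncomputable def conj {α : Type*} (s : Finset (L'.Formula α)) : L'.Formula α :=
  Formula.iInf (fun φ : s => (φ : L'.Formula α))

theorem realize_conj {α : Type*} {M : Type*} [L'.Structure M] (s : Finset (L'.Formula α))
    (v : α → M) : (conj s).Realize v ↔ ∀ φ ∈ s, φ.Realize v := by
  simp [conj]

theorem exists_realize_iff {α : Type*} {M N : Type u} [L'.Structure M] [L'.Structure N]
    [Nonempty M] [Nonempty N] (h : ∀ φ : L'.Sentence, M ⊨ φ ↔ N ⊨ φ) (φ : L'.Formula α) :
    (∃ v : α → M, φ.Realize v) ↔ ∃ v : α → N, φ.Realize v := by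
  classical
  have key : ∀ (K : Type u) [L'.Structure K] [Nonempty K],
      φ.exClosure.Realize K ↔ ∃ v : α → K, φ.Realize v := by
    intro K _ _
    rw [Formula.realize_exClosure]
    constructor
    · rintro ⟨v, hv⟩
      refine ⟨fun a => if ha : a ∈ φ.freeVarFinset then v ⟨a, ha⟩ else Classical.arbitrary K, ?_⟩
      exact (BoundedFormula.realize_restrictFreeVar _ (by intro a; simp)).1 hv
    · rintro ⟨v, hv⟩
      exact ⟨fun a => v a, (BoundedFormula.realize_restrictFreeVar v (by intro a; simp)).2 hv⟩
  rw [← key M, ← key N]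
  exact h _

/-- Compactness inside an ultrapower. -/
theorem exists_realize_of_finitely {α : Type u} {M : Type u} [L'.Structure M] [Nonempty M]
    (Q : Set (L'.Formula α))
    (hQ : ∀ s : Finset (L'.Formula α), ↑s ⊆ Q → ∃ v : α → M, ∀ φ ∈ s, φ.Realize v) :
    ∃ (N : Type u) (_ : L'.Structure N) (v : α → N), Nonempty N ∧
      (∀ φ : L'.Sentence, M ⊨ φ ↔ N ⊨ φ) ∧ ∀ φ ∈ Q, φ.Realize v := by
  classical
  have hQ' : ∀ s : Finset Q, ∃ v : α → M, ∀ φ ∈ s, (φ : L'.Formula α).Realize v := by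
    intro s
    obtain ⟨v, hv⟩ := hQ (s.image Subtype.val) (by intro x; simp; tauto)
    exact ⟨v, fun φ hφ => hv _ (Finset.mem_image_of_mem _ hφ)⟩
  choose v hv using hQ'
  let W : Ultrafilter (Finset Q) := Ultrafilter.of Filter.atTop
  refine ⟨(W : Filter (Finset Q)).Product fun _ => M, inferInstance,
    fun a => ((fun s => v s a : Finset Q → M) : (W : Filter (Finset Q)).Product fun _ => M),
    inferInstance, fun φ => ?_, fun φ hφ => ?_⟩
  · rw [Ultraproduct.sentence_realize]
    simp
  · refine (Ultraproduct.realize_formula_cast φ fun a s => v s a).2 ?_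
    refine (Ultrafilter.of_le (Filter.atTop : Filter (Finset Q))) ?_
    filter_upwards [Filter.eventually_ge_atTop ({⟨φ, hφ⟩} : Finset Q)] with s hs
    exact hv s ⟨φ, hφ⟩ (hs (by simp))

/-- Saturation phrased with parameters as assigned variables instead of constants. -/
def IsSat (L' : FirstOrder.Language.{u, u}) (κ : Cardinal.{u}) (M : Type u) [L'.Structure M] :
    Prop :=
  ∀ (B : Type u) (w : B → M), #B < κ → ∀ (m : ℕ) (p : Set (L'.Formula (B ⊕ Fin m))),
    (∀ s : Finset (L'.Formula (B ⊕ Fin m)), ↑s ⊆ p →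
      ∃ b : Fin m → M, ∀ φ ∈ s, φ.Realize (Sum.elim w b)) →
    ∃ b : Fin m → M, ∀ φ ∈ p, φ.Realize (Sum.elim w b)

/-- A set of pairs is a partial elementary map (in relational form). -/
def PartElem (L' : FirstOrder.Language.{u, u}) {M N : Type u} [L'.Structure M] [L'.Structure N]
    (P : Set (M × N)) : Prop :=
  ∀ (k : ℕ) (φ : L'.Formula (Fin k)) (t : Fin k → M × N), (∀ x, t x ∈ P) →
    (φ.Realize (fun x => (t x).1) ↔ φ.Realize (fun x => (t x).2))

section BackAndForth

variable {M N : Type u} [L'.Structure M] [L'.Structure N]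

theorem PartElem.swap {P : Set (M × N)} (h : PartElem L' P) :
    PartElem L' (Prod.swap ⁻¹' P) :=
  fun k φ t ht => (h k φ (fun x => (t x).swap) ht).symm

theorem PartElem.realize {P : Set (M × N)} (h : PartElem L' P) {α : Type*} (φ : L'.Formula α)
    (t : α → M × N) (ht : ∀ x, t x ∈ P) :
    φ.Realize (fun x => (t x).1) ↔ φ.Realize (fun x => (t x).2) := by
  classical
  let e := φ.freeVarFinset.equivFin
  let ψ : L'.Formula (Fin φ.freeVarFinset.card) :=
    BoundedFormula.restrictFreeVar φ (fun a => e a)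
  have hψ : ∀ (K : Type u) [L'.Structure K] (v : α → K),
      ψ.Realize (fun x => v (e.symm x)) ↔ φ.Realize v :=
    fun K _ v => BoundedFormula.realize_restrictFreeVar v (by simp)
  rw [← hψ M, ← hψ N]
  exact h _ ψ (fun x => t (e.symm x)) fun x => ht _

theorem PartElem.exists_insert {κ : Cardinal.{u}} (hN : IsSat L' κ N) {P : Set (M × N)}
    (h : PartElem L' P) (hP : #P < κ) (a : M) : ∃ b : N, PartElem L' (insert (a, b) P) := by
  classical
  let p : Set (L'.Formula (P ⊕ Fin 1)) :=
    {φ | φ.Realize (Sum.elim (fun x : P => (x : M × N).1) fun _ => a)}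
  obtain ⟨b, hb⟩ := hN P (fun x => (x : M × N).2) hP 1 p (by
    intro s hs
    have h1 : ((conj s).iExs (Fin 1)).Realize (fun x : P => (x : M × N).1) :=
      Formula.realize_iExs.2 ⟨fun _ => a, (realize_conj s _).2 fun φ hφ => hs hφ⟩
    obtain ⟨b, hb⟩ := Formula.realize_iExs.1 ((h.realize _ Subtype.val fun x => x.2).1 h1)
    exact ⟨b, (realize_conj s _).1 hb⟩)
  refine ⟨b 0, fun k φ t ht => ?_⟩
  let g : Fin k → P ⊕ Fin 1 := fun x => if hx : t x ∈ P then Sum.inl ⟨t x, hx⟩ else Sum.inr 0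
  have hg1 : (Sum.elim (fun x : P => (x : M × N).1) fun _ => a) ∘ g = fun x => (t x).1 := by
    funext x
    by_cases hx : t x ∈ P
    · simp [g, hx]
    · have h0 := (ht x).resolve_right hx
      simp only [g, Function.comp_apply, dif_neg hx, Sum.elim_inr]
      rw [h0]
  have hg2 : (Sum.elim (fun x : P => (x : M × N).2) b) ∘ g = fun x => (t x).2 := by
    funext x
    by_cases hx : t x ∈ P
    · simp [g, hx]
    · have h0 := (ht x).resolve_right hx
      simp only [g, Function.comp_apply, dif_neg hx, Sum.elim_inr]
      rw [h0]
  have key : ∀ ψ : L'.Formula (Fin k), ψ.Realize (fun x => (t x).1) →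
      ψ.Realize (fun x => (t x).2) := by
    intro ψ hψ
    have := hb (ψ.relabel g) (by
      change (ψ.relabel g).Realize _
      rw [Formula.realize_relabel, hg1]; exact hψ)
    rwa [Formula.realize_relabel, hg2] at this
  refine ⟨key φ, fun h2 => ?_⟩
  by_contra h1
  exact (Formula.realize_not.1 (key φ.not (Formula.realize_not.2 h1))) h2

/-- A total and surjective elementary relation is the graph of an isomorphism. -/
theorem PartElem.exists_equiv {P : Set (M × N)} (h : PartElem L' P)
    (hM : ∀ a, ∃ b, (a, b) ∈ P) (hN : ∀ b, ∃ a, (a, b) ∈ P) :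
    ∃ f : M ≃[L'] N, ∀ x ∈ P, f x.1 = x.2 := by
  have heq : ∀ x ∈ P, ∀ y ∈ P, x.1 = y.1 ↔ x.2 = y.2 := by
    intro x hx y hy
    have := h 2 (Term.equal (Term.var 0) (Term.var 1)) ![x, y] (by
      intro i; fin_cases i <;> simpa)
    simpa using this
  choose f hf using hM
  choose g hg using hN
  have hfP : ∀ x ∈ P, f x.1 = x.2 := fun x hx => (heq _ (hf x.1) x hx).1 rfl
  let e : M ≃ N := ⟨f, g, fun a => (heq _ (hg (f a)) _ (hf a)).2 rfl,
    fun b => (heq _ (hf (g b)) _ (hg b)).1 rfl⟩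
  refine ⟨⟨e, fun {n} F x => ?_, fun {n} r x => ?_⟩, hfP⟩
  · have := (h.realize (Term.equal (Term.var none) (Term.func F fun i => Term.var (some i)))
      (fun o : Option (Fin n) => o.elim (Structure.funMap F x, f (Structure.funMap F x))
        fun i => (x i, f (x i))) (by rintro (_ | i) <;> exact hf _)).1 (by simp)
    simp only [Formula.realize_equal] at this
    exact this
  · have := h.realize (r.formula fun i => Term.var i) (fun i => (x i, f (x i))) fun i => hf _
    simp only [Formula.realize_rel] at this
    exact this.symm

/-- Back-and-forth along a well-ordering of the disjoint union. -/
theorem PartElem.exists_extend {κ : Cardinal.{u}} (hκ : ℵ₀ ≤ κ) (hM : IsSat L' κ M)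
    (hN : IsSat L' κ N) (cM : #M = κ) (cN : #N = κ) {P : Set (M × N)} (h : PartElem L' P)
    (hP : #P < κ) : ∃ f : M ≃[L'] N, ∀ x ∈ P, f x.1 = x.2 := by
  classical
  let I := κ.ord.ToType
  have hI : #I = κ := by simp [I]
  obtain ⟨e⟩ : Nonempty (I ≃ M ⊕ N) := by
    rw [← Cardinal.eq]; simp [cM, cN, hI, Cardinal.add_eq_self hκ]
  have hκ0 : κ ≠ 0 := (aleph0_pos.trans_le hκ).ne'
  have : Nonempty (M × N) := by
    have h1 : Nonempty M := Cardinal.mk_ne_zero_iff.1 (by rw [cM]; exact hκ0)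
    have h2 : Nonempty N := Cardinal.mk_ne_zero_iff.1 (by rw [cN]; exact hκ0)
    infer_instance
  let good : I → Set (M × N) → M × N → Prop := fun i Q x =>
    Sum.elim (fun a => x.1 = a) (fun b => x.2 = b) (e i) ∧ PartElem L' (insert x Q)
  let s : I → M × N := wellFounded_lt.fix fun i S =>
    Classical.epsilon (good i (P ∪ range fun j : Iio i => S j j.2))
  have hs : ∀ i, s i = Classical.epsilon (good i (P ∪ range fun j : Iio i => s j)) :=
    fun i => wellFounded_lt.fix_eq _ i
  have hunion : ∀ J : Set I, (∀ i ∈ J, PartElem L' (P ∪ s '' Iic i)) →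
      PartElem L' (P ∪ s '' J) := by
    intro J hJ k φ t ht
    by_cases hall : ∀ x, t x ∈ P
    · exact h k φ t hall
    push Not at hall
    obtain ⟨x0, hx0⟩ := hall
    have hch : ∀ x : {x // t x ∉ P}, ∃ j : J, s j = t x := fun x => by
      obtain ⟨j, hj, hjx⟩ := (ht x).resolve_left x.2
      exact ⟨⟨j, hj⟩, hjx⟩
    choose g hg using hch
    have : Nonempty {x // t x ∉ P} := ⟨⟨x0, hx0⟩⟩
    obtain ⟨m, hm⟩ := Finite.exists_max g
    refine hJ (g m) (g m).2 k φ t fun x => ?_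
    by_cases hx : t x ∈ P
    · exact Or.inl hx
    · exact Or.inr ⟨g ⟨x, hx⟩, hm ⟨x, hx⟩, hg ⟨x, hx⟩⟩
  have hstep : ∀ i, PartElem L' (P ∪ s '' Iio i) → good i (P ∪ s '' Iio i) (s i) := by
    intro i hi
    have hrange : (range fun j : Iio i => s j) = s '' Iio i := by
      rw [image_eq_range]
    rw [hs i, hrange]
    apply Classical.epsilon_spec (p := good i (P ∪ s '' Iio i))
    have hc : #(P ∪ s '' Iio i : Set (M × N)) < κ :=
      (mk_union_le _ _).trans_lt (Cardinal.add_lt_of_lt hκ hP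
        (mk_image_le.trans_lt (((mk_Iio_lt i (by simp [I])).trans_eq hI))))
    rcases he : e i with a | b
    · obtain ⟨b, hb⟩ := hi.exists_insert hN hc a
      exact ⟨(a, b), by simp [he], hb⟩
    · have hc' : #(Prod.swap ⁻¹' (P ∪ s '' Iio i) : Set (N × M)) < κ := by
        refine lt_of_eq_of_lt ?_ hc
        exact mk_preimage_equiv (Equiv.prodComm N M) _
      obtain ⟨a, ha⟩ := hi.swap.exists_insert hM hc' b
      refine ⟨(a, b), by simp [he], ?_⟩
      convert ha.swap using 1
      ext ⟨x, y⟩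
      simp [and_comm]
  have hle : ∀ i, PartElem L' (P ∪ s '' Iic i) := by
    intro i
    induction i using WellFoundedLT.induction with
    | ind i ih =>
      have := (hstep i (hunion _ fun j hj => ih j hj)).2
      rwa [← union_insert, ← image_insert_eq, Iio_insert] at this
  have hgood : ∀ i, good i (P ∪ s '' Iio i) (s i) :=
    fun i => hstep i (hunion _ fun j _ => hle j)
  have hfull : PartElem L' (P ∪ s '' univ) := hunion _ fun j _ => hle j
  obtain ⟨f, hf⟩ := hfull.exists_equiv
    (fun a => ⟨(s (e.symm (.inl a))).2, Or.inr ⟨e.symm (.inl a), trivial, by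
      have := (hgood (e.symm (.inl a))).1
      simp at this
      ext <;> simp [this]⟩⟩)
    (fun b => ⟨(s (e.symm (.inr b))).1, Or.inr ⟨e.symm (.inr b), trivial, by
      have := (hgood (e.symm (.inr b))).1
      simp at this
      ext <;> simp [this]⟩⟩)
  exact ⟨f, fun x hx => hf x (Or.inl hx)⟩

end BackAndForth

section Existence

theorem mk_formula_lt {κ : Cardinal.{u}} (hκ : ℵ₀ < κ) (hL : L'.card < κ) {α : Type u}
    (hα : #α < κ) : #(L'.Formula α) < κ := by
  have h1 : #(L'.Formula α) ≤ #(Σ n, L'.BoundedFormula α n) :=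
    mk_le_of_injective (f := fun φ : L'.Formula α => (⟨0, φ⟩ : Σ n, L'.BoundedFormula α n))
      fun φ ψ h => by simpa using h
  refine (h1.trans BoundedFormula.card_le).trans_lt (max_lt hκ ?_)
  simpa using Cardinal.add_lt_of_lt hκ.le hα hL

theorem exists_forall_lt {κ : Cardinal.{u}} (hκ : κ.IsRegular) {B : Type u} (hB : #B < κ)
    (w : B → κ.ord.ToType) : ∃ i, ∀ b, w b < i := by
  by_contra! hcon
  have huniv : (⋃ b, Iic (w b)) = Set.univ :=
    eq_univ_of_forall fun i => mem_iUnion.2 (hcon i)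
  have hlt : #(⋃ b, Iic (w b)) < κ := by
    refine (card_iUnion_lt_iff_forall_of_isRegular hκ hB).2 fun b => ?_
    rw [← Iio_insert]
    refine mk_insert_le.trans_lt (Cardinal.add_lt_of_lt hκ.aleph0_le ?_
      (one_lt_aleph0.trans_le hκ.aleph0_le))
    exact (mk_Iio_lt (w b) (by simp)).trans_eq (by simp)
  rw [huniv] at hlt
  simp at hlt

theorem exists_bookkeeping {κ : Cardinal.{u}} (hκ : ℵ₀ ≤ κ) {T : Type u} [Nonempty T]
    (hT : #T ≤ κ) : ∃ g : κ.ord.ToType → T, ∀ t β, ∃ i, β ≤ i ∧ g i = t := by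
  have hI : #κ.ord.ToType = κ := by simp
  have hne : Nonempty κ.ord.ToType :=
    mk_ne_zero_iff.1 (by rw [hI]; exact (aleph0_pos.trans_le hκ).ne')
  obtain ⟨e⟩ : Nonempty (κ.ord.ToType × T ↪ κ.ord.ToType) := by
    rw [← Cardinal.le_def, mk_prod]
    simpa using Cardinal.mul_le_of_le hκ le_rfl hT
  refine ⟨fun i => (Function.invFun e i).2, fun t β => ?_⟩
  by_contra! hcon
  have hlt : ∀ i, e (i, t) < β := by
    intro i
    by_contra! h
    exact hcon _ h (by rw [Function.leftInverse_invFun e.injective])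
  have hle : #κ.ord.ToType ≤ #(Iio β) :=
    mk_le_of_injective (f := fun i => (⟨e (i, t), hlt i⟩ : Iio β)) fun i j h =>
      congrArg Prod.fst (e.injective (Subtype.ext_iff.1 h))
  exact absurd hle (mk_Iio_lt β (by simp)).not_ge

/-- The formulas imposed at stage `i` of the construction of a saturated model. -/
def stageFormulas {I : Type u} [LinearOrder I]
    (task : I → Σ β : I, Set (L'.Formula ((Iio β × ℕ) ⊕ ℕ))) (i : I) :
    Set (L'.Formula (I × ℕ)) :=
  {φ | (task i).1 ≤ i ∧ φ ∈ (fun ψ : L'.Formula ((Iio (task i).1 × ℕ) ⊕ ℕ) =>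
    ψ.relabel (Sum.elim (fun x => ((x.1 : I), x.2)) fun k => (i, k))) '' (task i).2}

theorem realize_stageFormulas_congr {I : Type u} [LinearOrder I]
    {task : I → Σ β : I, Set (L'.Formula ((Iio β × ℕ) ⊕ ℕ))} {i : I} {φ : L'.Formula (I × ℕ)}
    (hφ : φ ∈ stageFormulas task i) {M : Type u} [L'.Structure M] {v v' : I × ℕ → M}
    (hv : ∀ x : I × ℕ, x.1 ≤ i → v x = v' x) (h : φ.Realize v) : φ.Realize v' := by
  obtain ⟨hle, ψ, hψ, rfl⟩ := hφ
  rw [Formula.realize_relabel] at h ⊢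
  convert h using 1
  funext x
  rcases x with ⟨⟨j, hj⟩, k⟩ | k
  · exact (hv _ ((show j < _ from hj).le.trans hle)).symm
  · exact (hv _ le_rfl).symm

theorem exists_weakly_saturated {κ : Cardinal.{u}} (hκ : κ.IsInaccessible) (hL : L'.card < κ)
    (M : Type u) [L'.Structure M] [Nonempty M] :
    ∃ (N : Type u) (_ : L'.Structure N) (v : κ.ord.ToType × ℕ → N), Nonempty N ∧
      (∀ φ : L'.Sentence, M ⊨ φ ↔ N ⊨ φ) ∧
      ∀ (β : κ.ord.ToType) (p : Set (L'.Formula ((Iio β × ℕ) ⊕ ℕ))),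
        (∀ s : Finset (L'.Formula ((Iio β × ℕ) ⊕ ℕ)), ↑s ⊆ p → ∃ b : ℕ → N,
          ∀ φ ∈ s, φ.Realize (Sum.elim (fun x => v (x.1, x.2)) b)) →
        ∃ b : ℕ → κ.ord.ToType × ℕ,
          ∀ φ ∈ p, φ.Realize (Sum.elim (fun x => v (x.1, x.2)) (v ∘ b)) := by
  classical
  have hI : #κ.ord.ToType = κ := by simp
  have hne : Nonempty κ.ord.ToType :=
    mk_ne_zero_iff.1 (by rw [hI]; exact hκ.ne_zero)
  have hcard : #(Σ β : κ.ord.ToType, Set (L'.Formula ((Iio β × ℕ) ⊕ ℕ))) ≤ κ := by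
    rw [mk_sigma]
    refine (sum_le_sum _ (fun _ => κ) fun β => ?_).trans ?_
    · rw [mk_set]
      refine (hκ.isStrongPrelimit (mk_formula_lt hκ.aleph0_lt hL ?_)).le
      have hβ : #(Iio β) < κ := (mk_Iio_lt β (by simp)).trans_eq hI
      simpa using Cardinal.add_lt_of_lt hκ.aleph0_lt.le
        (Cardinal.mul_lt_of_lt hκ.aleph0_lt.le hβ hκ.aleph0_lt) hκ.aleph0_lt
    · rw [sum_const', hI, Cardinal.mul_eq_self hκ.aleph0_lt.le]
  have : Nonempty (Σ β : κ.ord.ToType, Set (L'.Formula ((Iio β × ℕ) ⊕ ℕ))) :=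
    ⟨⟨Classical.arbitrary _, ∅⟩⟩
  obtain ⟨task, htask⟩ := exists_bookkeeping hκ.aleph0_lt.le hcard
  obtain ⟨S, hS, hfin, hgreedy⟩ := exists_greedy
    (fun s : Finset (L'.Formula (κ.ord.ToType × ℕ)) =>
      ∃ v : κ.ord.ToType × ℕ → M, ∀ φ ∈ s, φ.Realize v)
    ⟨fun _ => Classical.arbitrary M, by simp⟩ (stageFormulas task)
  obtain ⟨N, iN, v, hN, hMN, hv⟩ := exists_realize_of_finitely (⋃ i, S i) hfin
  refine ⟨N, iN, v, hN, hMN, fun β p hp => ?_⟩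
  obtain ⟨i, hβi, hi⟩ := htask ⟨β, p⟩ β
  have hstage : stageFormulas task i = (fun ψ : L'.Formula ((Iio β × ℕ) ⊕ ℕ) =>
      ψ.relabel (Sum.elim (fun x => ((x.1 : κ.ord.ToType), x.2)) fun k => (i, k))) '' p := by
    ext φ
    rw [stageFormulas, mem_ofPred_eq, hi]
    exact and_iff_right hβi
  have hSi : S i = stageFormulas task i := by
    refine hgreedy i fun s hs => ?_
    suffices h : ∃ v : κ.ord.ToType × ℕ → N, ∀ φ ∈ s, φ.Realize v by
      simp only [← realize_conj] at h ⊢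
      exact (exists_realize_iff hMN _).2 h
    obtain ⟨s', hs', hs's⟩ := Finset.subset_set_image_iff.1
      (show (↑(s.filter (· ∈ stageFormulas task i)) : Set (L'.Formula (κ.ord.ToType × ℕ))) ⊆
        (fun ψ : L'.Formula ((Iio β × ℕ) ⊕ ℕ) =>
          ψ.relabel (Sum.elim (fun x => ((x.1 : κ.ord.ToType), x.2)) fun k => (i, k))) '' p
      from fun φ hφ => hstage.subset (Finset.mem_filter.1 hφ).2)
    obtain ⟨b, hb⟩ := hp s' hs'
    refine ⟨fun x => if x.1 = i then b x.2 else v x, fun φ hφ => ?_⟩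
    rcases hs hφ with h | h
    · obtain ⟨⟨j, hj⟩, hφj⟩ := mem_iUnion.1 h
      refine realize_stageFormulas_congr (hS j hφj) (fun x hx => ?_)
        (hv φ (mem_iUnion.2 ⟨j, hφj⟩))
      rw [if_neg]
      rintro rfl
      exact absurd hj (not_lt.2 hx)
    · have hmem : φ ∈ s.filter (· ∈ stageFormulas task i) := Finset.mem_filter.2 ⟨hφ, h⟩
      rw [← hs's] at hmem
      obtain ⟨ψ, hψ, rfl⟩ := Finset.mem_image.1 hmem
      rw [Formula.realize_relabel]
      convert hb ψ hψ using 1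
      funext x
      rcases x with ⟨⟨j, hj⟩, k⟩ | k
      · simp [((show j < β from hj).trans_le hβi).ne]
      · simp
  refine ⟨fun k => (i, k), fun φ hφ => ?_⟩
  have hmem : φ.relabel (Sum.elim (fun x => ((x.1 : κ.ord.ToType), x.2)) fun k => (i, k)) ∈
      S i := by
    rw [hSi, hstage]
    exact ⟨φ, hφ, rfl⟩
  have := hv _ (mem_iUnion.2 ⟨i, hmem⟩)
  rw [Formula.realize_relabel] at this
  convert this using 1
  funext x
  rcases x with x | k <;> rfl

theorem exists_isSat {κ : Cardinal.{u}} (hκ : κ.IsInaccessible) (hL : L'.card < κ)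
    (M : Type u) [L'.Structure M] [Infinite M] :
    ∃ (N : Type u) (_ : L'.Structure N), #N = κ ∧ IsSat L' κ N ∧
      ∀ φ : L'.Sentence, M ⊨ φ ↔ N ⊨ φ := by
  classical
  obtain ⟨N, iN, v, hN, hMN, hv⟩ := exists_weakly_saturated hκ hL M
  have hsat : ∀ (B : Type u) (w : B → range v), #B < κ → ∀ (m : ℕ)
      (p : Set (L'.Formula (B ⊕ Fin m))),
      (∀ s : Finset (L'.Formula (B ⊕ Fin m)), ↑s ⊆ p → ∃ b : Fin m → N,
        ∀ φ ∈ s, φ.Realize (Sum.elim (fun x => (w x : N)) b)) →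
      ∃ b : Fin m → range v, ∀ φ ∈ p,
        φ.Realize (Sum.elim (fun x => (w x : N)) fun i => (b i : N)) := by
    intro B w hB m p hp
    choose u hu using fun b => (w b).2
    obtain ⟨β, hβ⟩ := exists_forall_lt hκ.isRegular hB fun b => (u b).1
    let r : B ⊕ Fin m → (Iio β × ℕ) ⊕ ℕ :=
      Sum.map (fun b => (⟨(u b).1, hβ b⟩, (u b).2)) Fin.val
    have hr : ∀ b : ℕ → N, Sum.elim (fun x : Iio β × ℕ => v (x.1, x.2)) b ∘ r =
        Sum.elim (fun x => (w x : N)) fun i : Fin m => b i := by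
      intro b
      funext x
      rcases x with x | x
      · exact hu x
      · rfl
    obtain ⟨b, hb⟩ := hv β ((fun φ : L'.Formula (B ⊕ Fin m) => φ.relabel r) '' p) (by
      intro s hs
      obtain ⟨s', hs', rfl⟩ := Finset.subset_set_image_iff.1 hs
      obtain ⟨b, hb⟩ := hp s' hs'
      refine ⟨fun k => if hk : k < m then b ⟨k, hk⟩ else Classical.arbitrary N, fun φ hφ => ?_⟩
      obtain ⟨ψ, hψ, rfl⟩ := Finset.mem_image.1 hφ
      rw [Formula.realize_relabel, hr]
      simpa using hb ψ hψ)
    refine ⟨fun i => ⟨v (b i), mem_range_self _⟩, fun φ hφ => ?_⟩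
    have := hb _ (mem_image_of_mem _ hφ)
    rwa [Formula.realize_relabel, hr] at this
  have hfin : ∀ k : ℕ, #(ULift.{u} (Fin k)) < κ := fun k => by simpa using hκ.nat_lt k
  have hone : ∀ (k : ℕ) (w : Fin k → range v) (φ : L'.Formula (Fin k ⊕ Fin 1)) (a : N),
      φ.Realize (Sum.elim (fun x => (w x : N)) fun _ => a) →
      ∃ b : range v, φ.Realize (Sum.elim (fun x => (w x : N)) fun _ => (b : N)) := by
    intro k w φ a ha
    have hre : ∀ c : Fin 1 → N,
        (φ.relabel (Sum.map ULift.up.{u} id)).Realize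
          (Sum.elim (fun x : ULift.{u} (Fin k) => (w x.down : N)) c) ↔
        φ.Realize (Sum.elim (fun x => (w x : N)) c) := by
      intro c
      rw [Formula.realize_relabel]
      simp [Function.comp_def, Sum.elim_map]
    obtain ⟨b, hb⟩ := hsat (ULift.{u} (Fin k)) (fun x => w x.down) (hfin k) 1
      {φ.relabel (Sum.map ULift.up.{u} id)} (by
        intro s hs
        refine ⟨fun _ => a, fun ψ hψ => ?_⟩
        obtain rfl := mem_singleton_iff.1 (hs hψ)
        exact (hre _).2 ha)
    refine ⟨b 0, ?_⟩
    have := (hre _).1 (hb _ rfl)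
    convert this using 3 with i
    rw [Subsingleton.elim i 0]
  let S : L'.Substructure N :=
    { carrier := range v
      fun_mem := by
        intro k f x hx
        obtain ⟨b, hb⟩ := hone k (fun i => ⟨x i, hx i⟩)
          (Term.equal (Term.var (Sum.inr 0)) (Term.func f fun i => Term.var (Sum.inl i)))
          (Structure.funMap f x) (by simp)
        have hb' : (b : N) = Structure.funMap f x := by simpa using hb
        rw [← hb']
        exact b.2 }
  let E : L'.ElementarySubstructure N := S.toElementarySubstructure (by
    intro k φ x a ha
    have hre : ∀ c : N, (φ.toFormula.relabel (Sum.elim Empty.elim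
        (Fin.snoc (α := fun _ => Fin k ⊕ Fin 1) Sum.inl (Sum.inr 0)))).Realize
          (Sum.elim (fun i => (x i : N)) fun _ => c) ↔
        φ.Realize default (Fin.snoc ((↑) ∘ x) c : _ → N) := by
      intro c
      rw [Formula.realize_relabel, BoundedFormula.realize_toFormula]
      refine iff_of_eq (congrArg₂ (BoundedFormula.Realize φ) (Subsingleton.elim _ _) ?_)
      funext i
      refine Fin.lastCases ?_ (fun i => ?_) i <;> simp
    obtain ⟨b, hb⟩ := hone k x _ a ((hre a).2 ha)
    exact ⟨b, (hre b).1 hb⟩)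
  have hE : ∀ {α : Type u} (φ : L'.Formula α) (x : α → E),
      φ.Realize (fun i => (x i : N)) ↔ φ.Realize x :=
    fun φ x => E.subtype.map_formula φ x
  have hNinf : Infinite N := by
    by_contra hcon
    rw [not_infinite_iff_finite] at hcon
    have h := (hMN (Sentence.cardGe L' (Nat.card N + 1))).1 (by
      rw [Sentence.realize_cardGe]
      exact (natCast_lt_aleph0.le).trans (aleph0_le_mk M))
    rw [Sentence.realize_cardGe, ← Nat.cast_card (α := N), Nat.cast_le] at h
    omega
  refine ⟨E, inferInstance, le_antisymm ?_ ?_, ?_, fun φ => ?_⟩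
  · refine (mk_range_le (f := v)).trans ?_
    simp [hκ.aleph0_lt.le]
  · by_contra! hcon
    obtain ⟨b, hb⟩ := hsat (range v) id hcon 1
      (range fun x : range v => (Term.equal (Term.var (Sum.inr 0)) (Term.var (Sum.inl x))).not) (by
        intro s hs
        have hs' : ↑s ⊆ (fun x : range v => (Term.equal (Term.var (Sum.inr 0))
          (Term.var (Sum.inl x)) : L'.Formula (range v ⊕ Fin 1)).not) '' Set.univ := by
          rwa [image_univ]
        obtain ⟨t, -, rfl⟩ := Finset.subset_set_image_iff.1 hs'
        obtain ⟨a, ha⟩ := Infinite.exists_notMem_finset (t.image Subtype.val)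
        refine ⟨fun _ => a, fun φ hφ => ?_⟩
        obtain ⟨x, hx, rfl⟩ := Finset.mem_image.1 hφ
        rw [Formula.realize_not, Formula.realize_equal]
        intro h
        exact ha (Finset.mem_image.2 ⟨x, hx, h.symm⟩))
    have := hb _ (mem_range_self (b 0))
    rw [Formula.realize_not, Formula.realize_equal] at this
    exact this rfl
  · intro B w hB m p hp
    have hcomp : ∀ b : Fin m → E, (fun x => ((Sum.elim w b x : E) : N)) =
        Sum.elim (fun x => (w x : N)) fun i => (b i : N) := by
      intro b; funext x; cases x <;> rfl
    obtain ⟨b, hb⟩ : ∃ b : Fin m → E, ∀ φ ∈ p,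
        φ.Realize (Sum.elim (fun x => (w x : N)) fun i => (b i : N)) := hsat B w hB m p (by
      intro s hs
      obtain ⟨b, hb⟩ := hp s hs
      refine ⟨fun i => (b i : N), fun φ hφ => ?_⟩
      rw [← hcomp, hE]
      exact hb φ hφ)
    refine ⟨b, fun φ hφ => ?_⟩
    rw [← hE, hcomp]
    exact hb φ hφ
  · rw [hMN]
    exact (E.subtype.map_sentence φ).symm

end Existence

section Transfer

theorem isExpansionOn_addConsts {M : Type u} (S : L'.Structure M) (A : Set M) :
    @LHom.IsExpansionOn _ _ (lhomWithConstants L' A) M S (addConsts M S A) := by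
  let := S
  let : (constantsOn ↥A).Structure M := constantsOn.structure Subtype.val
  exact LHom.sumInl_isExpansionOn M

theorem frealize_addConsts_iff {M : Type u} [S : L'.Structure M] (A : Set M) {α : Type*}
    (φ : (L'[[↥A]]).Formula α) (v : α → M) :
    FRealize M (addConsts M S A) φ v ↔
      Formula.Realize (BoundedFormula.constantsVarsEquiv φ : L'.Formula (A ⊕ α))
        (Sum.elim Subtype.val v) := by
  let := addConsts M S A
  have := isExpansionOn_addConsts S A
  exact (BoundedFormula.realize_constantsVarsEquiv (φ := φ) (v := v) (xs := default)).symm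

theorem sentRealize_addConsts_iff {M : Type u} [S : L'.Structure M] (A : Set M)
    (φ : (L'[[↥A]]).Sentence) :
    SentRealize M (addConsts M S A) φ ↔
      (Formula.equivSentence.symm φ).Realize (Subtype.val : A → M) := by
  let := addConsts M S A
  have := isExpansionOn_addConsts S A
  exact (Formula.realize_equivSentence_symm_con M φ).symm

theorem IsSatStr.isSat {M : Type u} [S : L'.Structure M] (h : IsSatStr M S) :
    IsSat L' #M M := by
  classical
  intro B w hB m p hp
  let g : L'.Formula (B ⊕ Fin m) → (L'[[↥(range w)]]).Formula (Fin m) := fun φ =>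
    BoundedFormula.constantsVarsEquiv.symm (φ.relabel (Sum.map (rangeFactorization w) id))
  have hg : ∀ φ b, FRealize M (addConsts M S (range w)) (g φ) b ↔
      φ.Realize (Sum.elim w b) := by
    intro φ b
    rw [frealize_addConsts_iff, Equiv.apply_symm_apply, Formula.realize_relabel, Sum.elim_comp_map]
    rfl
  obtain ⟨b, hb⟩ := h (range w) (mk_range_le.trans_lt hB) m (g '' p) (by
    intro s hs
    obtain ⟨t, ht, rfl⟩ := Finset.subset_set_image_iff.1 hs
    obtain ⟨b, hb⟩ := hp t ht
    refine ⟨b, fun φ hφ => ?_⟩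
    obtain ⟨ψ, hψ, rfl⟩ := Finset.mem_image.1 hφ
    exact (hg ψ b).2 (hb ψ hψ))
  exact ⟨b, fun φ hφ => (hg φ b).1 (hb _ (mem_image_of_mem g hφ))⟩

theorem IsSat.isSatStr {M : Type u} [S : L'.Structure M] (h : IsSat L' #M M) :
    IsSatStr M S := by
  classical
  intro A hA m p hp
  let g : (L'[[↥A]]).Formula (Fin m) → L'.Formula (A ⊕ Fin m) := fun φ =>
    BoundedFormula.constantsVarsEquiv φ
  have hg : ∀ φ b, FRealize M (addConsts M S A) φ b ↔
      (g φ).Realize (Sum.elim Subtype.val b) := fun φ b => frealize_addConsts_iff A φ b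
  obtain ⟨b, hb⟩ := h A Subtype.val hA m (g '' p) (by
    intro s hs
    obtain ⟨t, ht, rfl⟩ := Finset.subset_set_image_iff.1 hs
    obtain ⟨b, hb⟩ := hp t ht
    refine ⟨b, fun φ hφ => ?_⟩
    obtain ⟨ψ, hψ, rfl⟩ := Finset.mem_image.1 hφ
    exact (hg ψ b).1 (hb ψ hψ))
  exact ⟨b, fun φ hφ => (hg φ b).2 (hb _ (mem_image_of_mem g hφ))⟩

theorem IsSat.reduct {L₁ : FirstOrder.Language.{u, u}} {κ : Cardinal.{u}} {M : Type u}
    [L'.Structure M] [L₁.Structure M] (g : L' →ᴸ L₁) [g.IsExpansionOn M] (h : IsSat L₁ κ M) :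
    IsSat L' κ M := by
  classical
  intro B w hB m p hp
  obtain ⟨b, hb⟩ := h B w hB m (g.onFormula '' p) (by
    intro s hs
    obtain ⟨t, ht, rfl⟩ := Finset.subset_set_image_iff.1 hs
    obtain ⟨b, hb⟩ := hp t ht
    refine ⟨b, fun φ hφ => ?_⟩
    obtain ⟨ψ, hψ, rfl⟩ := Finset.mem_image.1 hφ
    exact (LHom.realize_onFormula g ψ).2 (hb ψ hψ))
  exact ⟨b, fun φ hφ => (LHom.realize_onFormula g φ).1 (hb _ (mem_image_of_mem _ hφ))⟩

theorem IsSat.congr {κ : Cardinal.{u}} {M N : Type u} [L'.Structure M] [L'.Structure N]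
    (f : M ≃[L'] N) (h : IsSat L' κ M) : IsSat L' κ N := by
  have hf : ∀ {B : Type u} {m : ℕ} (w : B → N) (b : Fin m → M) (φ : L'.Formula (B ⊕ Fin m)),
      φ.Realize (Sum.elim w (f ∘ b)) ↔ φ.Realize (Sum.elim (f.symm ∘ w) b) := by
    intro B m w b φ
    rw [← StrongHomClass.realize_formula f φ]
    refine iff_of_eq (congrArg _ ?_)
    funext x
    cases x <;> simp
  intro B w hB m p hp
  obtain ⟨b, hb⟩ := h B (f.symm ∘ w) hB m p fun s hs => by
    obtain ⟨b, hb⟩ := hp s hs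
    refine ⟨f.symm ∘ b, fun φ hφ => (hf w _ φ).1 ?_⟩
    convert hb φ hφ using 2
    funext x
    simp
  exact ⟨f ∘ b, fun φ hφ => (hf w b φ).2 (hb φ hφ)⟩

end Transfer

theorem card_predLang_le (n : ℕ) : (predLang.{u} n).card ≤ ℵ₀ := by
  have h : Countable (predLang.{u} n).Symbols := by
    have : ∀ m, Countable ((predLang.{u} n).Functions m) := fun m =>
      inferInstanceAs (Countable PEmpty)
    have : ∀ m, Countable ((predLang.{u} n).Relations m) := fun m =>
      inferInstanceAs (Countable (ULift (PLift (m = n))))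
    exact inferInstanceAs (Countable (_ ⊕ _))
  exact mk_le_aleph0_iff.2 h

theorem eqvOver_iff {L : FirstOrder.Language.{u, u}} {U : Type u} [L.Structure U] {n : ℕ}
    {A : Set U} {C D : Set (Fin n → U)} :
    EqvOver L U A C D ↔ ∀ φ : (expLang L n).Formula A,
      FRealize U (expStr L U C) φ Subtype.val ↔ FRealize U (expStr L U D) φ Subtype.val := by
  refine ⟨fun h φ => ?_, fun h φ => ?_⟩
  · have := h (Formula.equivSentence φ)
    rwa [sentRealize_addConsts_iff (S := expStr L U C),
      sentRealize_addConsts_iff (S := expStr L U D), Equiv.symm_apply_apply] at this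
  · rw [sentRealize_addConsts_iff (S := expStr L U C),
      sentRealize_addConsts_iff (S := expStr L U D)]
    exact h _

/-- The inclusion of `L` into `expLang L n`. -/
def toExp (L : FirstOrder.Language.{u, u}) (n : ℕ) : L →ᴸ expLang L n :=
  LHom.sumInl

/-- The new predicate of `expLang L n`. -/
def predSymb (L : FirstOrder.Language.{u, u}) (n : ℕ) : (expLang L n).Relations n :=
  Sum.inr ⟨⟨rfl⟩⟩

/-- `PartElem.exists_extend` without bundling, usable with two structures on the same type. -/
theorem PartElem.exists_extend_unbundled {κ : Cardinal.{u}} (hκ : ℵ₀ ≤ κ) {M N : Type u}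
    [L'.Structure M] [L'.Structure N] (hM : IsSat L' κ M) (hN : IsSat L' κ N) (cM : #M = κ)
    (cN : #N = κ) {P : Set (M × N)} (h : PartElem L' P) (hP : #P < κ) :
    ∃ f : M ≃ N, (∀ x ∈ P, f x.1 = x.2) ∧
      (∀ (k : ℕ) (F : L'.Functions k) (x : Fin k → M),
        f (Structure.funMap F x) = Structure.funMap F (f ∘ x)) ∧
      ∀ (k : ℕ) (r : L'.Relations k) (x : Fin k → M),
        Structure.RelMap r (f ∘ x) ↔ Structure.RelMap r x := by
  obtain ⟨f, hf⟩ := h.exists_extend hκ hM hN cM cN hP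
  exact ⟨f.toEquiv, hf, fun _ => f.map_fun', fun _ => f.map_rel'⟩

theorem exists_aut_of_eqvOver {L : FirstOrder.Language.{u, u}} {U : Type u} [L.Structure U]
    (hU : ℵ₀ ≤ #U) {n : ℕ} {A : Set U} (hA : #A < #U) {C D : Set (Fin n → U)}
    (hD : SatSet L U D) (hC : SatSet L U C) (h : EqvOver L U A C D) :
    ∃ f ∈ AutFix L U A, imgSet L U f D = C := by
  rw [eqvOver_iff] at h
  have hP : @PartElem (expLang L n) U U (expStr L U D) (expStr L U C)
      (range fun a : A => ((a : U), (a : U))) := by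
    intro k φ t ht
    choose g hg using ht
    obtain rfl : t = fun x => ((g x : U), (g x : U)) := funext fun x => (hg x).symm
    have := (h (φ.relabel g)).symm
    simp only [FRealize, Formula.realize_relabel] at this
    exact this
  obtain ⟨f, hf, hfun, hrel⟩ := @PartElem.exists_extend_unbundled (expLang L n) #U hU U U
    (expStr L U D) (expStr L U C)
    (@IsSatStr.isSat _ U (expStr L U D) hD) (@IsSatStr.isSat _ U (expStr L U C) hC) rfl rfl _ hP
    (mk_range_le.trans_lt hA)
  let f' : U ≃[L] U :=
    ⟨f, fun {k} F x => hfun k (Sum.inl F) x, fun {k} r x => hrel k (Sum.inl r) x⟩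
  have hrel : ∀ x : Fin n → U, f ∘ x ∈ C ↔ x ∈ D := fun x => hrel n (predSymb L n) x
  refine ⟨f', fun a ha => hf _ ⟨⟨a, ha⟩, rfl⟩, ?_⟩
  ext y
  refine ⟨?_, fun hy => ⟨f.symm ∘ y, (hrel _).1 ?_, ?_⟩⟩
  · rintro ⟨x, hx, rfl⟩
    exact (hrel x).2 hx
  · rwa [← Function.comp_assoc, f.self_comp_symm, Function.id_comp]
  · funext i
    exact f.apply_symm_apply _

theorem exists_satSet_eqvOver {L : FirstOrder.Language.{u, u}} {U : Type u} [iS : L.Structure U]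
    (hsat : IsSatStr U iS) (hinacc : Cardinal.IsInaccessible #U) (hcard : L.card < #U)
    {n : ℕ} (D : Set (Fin n → U)) {A : Set U} (hA : #A < #U) :
    ∃ C : Set (Fin n → U), SatSet L U C ∧ EqvOver L U A C D := by
  have hinf : Infinite U := infinite_iff.2 hinacc.aleph0_lt.le
  have hL : ((expLang L n)[[↥A]]).card < #U := by
    rw [card_withConstants, expLang, card_sum]
    simp only [lift_id]
    exact Cardinal.add_lt_of_lt hinacc.aleph0_lt.le (Cardinal.add_lt_of_lt hinacc.aleph0_lt.le
      hcard ((card_predLang_le n).trans_lt hinacc.aleph0_lt)) hA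
  obtain ⟨N, iN, cN, hN, hUN⟩ := @exists_isSat _ _ hinacc hL U
    (addConsts U (expStr L U D) A) hinf
  let iN₁ : (expLang L n).Structure N := (lhomWithConstants (expLang L n) A).reduct N
  let iN₂ : L.Structure N := (toExp L n).reduct N
  have hN₁ : IsSat (expLang L n) #U N := hN.reduct (lhomWithConstants (expLang L n) A)
  have hN₂ : IsSat L #U N := hN₁.reduct (toExp L n)
  let h : A → N := fun a => ((expLang L n).con a : (expLang L n)[[↥A]].Constants)
  have hh : ∀ φ : (expLang L n).Formula A, φ.Realize h ↔
      FRealize U (expStr L U D) φ Subtype.val := by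
    intro φ
    have h1 := hUN (Formula.equivSentence φ)
    have h2 := sentRealize_addConsts_iff (S := expStr L U D) A (Formula.equivSentence φ)
    rw [Equiv.symm_apply_apply] at h2
    exact (Formula.realize_equivSentence N φ).symm.trans (h1.symm.trans h2)
  let : (expLang L n).Structure U := expStr L U D
  have hexp : (toExp L n).IsExpansionOn U :=
    ⟨fun _ _ => rfl, fun _ _ => rfl⟩
  have hP : PartElem L (range fun a : A => (h a, (a : U))) := by
    intro k φ t ht
    choose g hg using ht
    obtain rfl : t = fun x => (h (g x), (g x : U)) := funext fun x => (hg x).symm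
    have := hh (((toExp L n).onFormula φ).relabel g)
    rw [FRealize, Formula.realize_relabel, Formula.realize_relabel, LHom.realize_onFormula,
      LHom.realize_onFormula] at this
    exact this
  obtain ⟨f, hf⟩ := hP.exists_extend hinacc.aleph0_lt.le hN₂ hsat.isSat cN rfl
    (mk_range_le.trans_lt hA)
  let C : Set (Fin n → U) := {x | Structure.RelMap (predSymb L n) (f.symm ∘ x)}
  let iC : (expLang L n).Structure U := expStr L U C
  let f₁ : N ≃[expLang L n] U :=
    { f.toEquiv with
      map_fun' := by
        rintro k (F | F) x
        · exact f.map_fun' F x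
        · exact F.elim
      map_rel' := by
        rintro k (r | ⟨⟨e⟩⟩) x
        · exact f.map_rel' r x
        · obtain rfl : n = k := e.down.symm
          change Structure.RelMap (predSymb L n) (f.symm ∘ f ∘ x) ↔ _
          rw [← Function.comp_assoc]
          have : ⇑f.symm ∘ ⇑f = id := by funext y; simp
          rw [this]
          rfl }
  refine ⟨C, (hN₁.congr f₁).isSatStr, eqvOver_iff.2 fun φ => ?_⟩
  rw [← hh, ← StrongHomClass.realize_formula f₁ φ]
  refine iff_of_eq (congrArg (Formula.Realize (L := expLang L n) φ) ?_)
  funext a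
  exact (hf _ ⟨a, rfl⟩).symm

/-- for every `D` and small `A` there is a saturated `C` with
`⟨U,C⟩ ≡_A ⟨U,D⟩`; moreover any two saturated, `A`-elementarily-equivalent expansions are
conjugate by an automorphism of `U` fixing `A`. -/
theorem stmt0 (L : FirstOrder.Language.{u, u}) (U : Type u) [iS : L.Structure U]
    (hsat : IsSatStr U iS) (hinacc : Cardinal.IsInaccessible #U) (hcard : L.card < #U)
    (n : ℕ) (D : Set (Fin n → U)) (A : Set U) (hA : #A < #U) :
    (∃ C : Set (Fin n → U), SatSet L U C ∧ EqvOver L U A C D) ∧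
    (∀ C : Set (Fin n → U), SatSet L U D → SatSet L U C → EqvOver L U A C D →
      ∃ f ∈ AutFix L U A, imgSet L U f D = C) := by
  exact ⟨exists_satSet_eqvOver hsat hinacc hcard D hA, fun C hD hC h =>
    exists_aut_of_eqvOver hinacc.aleph0_lt.le hA hD hC h⟩

end Paper
end

section
/- Assume C ⊆ U^{|z|} is saturated and o(C/A) has finite VC-dimension. Let M ⪯ U be a model that is L(A;C)-saturated. Then every global type p(z) ∈ S_z(U) that is invariant over A contains a formula ψ(z) with parameters in M such that either ψ(U) ⊆ C or ψ(U) ⊆ U^{|z|} ∖ C. -/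
namespace Paper

open FirstOrder Language Cardinal Set

universe u

variable (L : FirstOrder.Language.{u, u}) (U : Type u) [iS : L.Structure U]

section Parameters

variable {L U}

/-- Substitute constants for the variables in the right summand. -/
def paramFormula {L' : FirstOrder.Language.{u, u}} {α γ : Type*} {B : Type u}
    (φ : L'.Formula (α ⊕ γ)) (c : γ → B) : (L'[[B]]).Formula α :=
  ((L'.lhomWithConstants B).onFormula φ).subst
    (Sum.elim Term.var fun j => (L'.con (c j)).term)

theorem realize_paramFormula {L' : FirstOrder.Language.{u, u}} {S : L'.Structure U} {α γ : Type*}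
    {B : Set U} (φ : L'.Formula (α ⊕ γ)) (c : γ → B) (d : α → U) :
    FRealize U (addConsts U S B) (paramFormula φ c) d ↔
      FRealize U S φ (Sum.elim d fun j => (c j : U)) := by
  let := S
  let _ : (constantsOn ↥B).Structure U := constantsOn.structure Subtype.val
  refine (BoundedFormula.realize_subst (L := L'[[B]]) (M := U)).trans ?_
  refine (LHom.realize_onFormula (L'.lhomWithConstants B) φ).trans ?_
  refine iff_of_eq (congrArg _ ?_)
  ext (j | j)
  · rfl
  · exact Term.realize_constants

theorem realize_paramFormula_all {L' : FirstOrder.Language.{u, u}} {S : L'.Structure U}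
    {α γ : Type*} (φ : L'.Formula (α ⊕ γ)) (c : γ → U) (d : α → U) :
    FRealize U (addAllConsts U S) (paramFormula φ c) d ↔ FRealize U S φ (Sum.elim d c) := by
  let := S
  let _ : (constantsOn U).Structure U := constantsOn.structure id
  refine (BoundedFormula.realize_subst (L := L'[[U]]) (M := U)).trans ?_
  refine (LHom.realize_onFormula (L'.lhomWithConstants U) φ).trans ?_
  refine iff_of_eq (congrArg _ ?_)
  ext (j | j)
  · rfl
  · exact Term.realize_constants

theorem realize_liftConsts (M : Set U) {α : Type*} (ψ : (L[[↥M]]).Formula α) (d : α → U) :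
    FRealize U (addAllConsts U iS) ((liftConsts L U M).onFormula ψ) d ↔
      FRealize U (addConsts U iS M) ψ d := by
  let i₁ : (constantsOn ↥M).Structure U := constantsOn.structure Subtype.val
  let i₂ : (constantsOn U).Structure U := constantsOn.structure id
  have : (LHom.constantsOnMap (Subtype.val : M → U)).IsExpansionOn U :=
    constantsOnMap_isExpansionOn rfl
  exact @LHom.realize_onFormula _ _ U (addConsts U iS M) α (addAllConsts U iS) (liftConsts L U M)
    (LHom.sumMap_isExpansionOn (LHom.id L) (LHom.constantsOnMap (Subtype.val : M → U)) U) ψ d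

theorem IsSatStr.exists_realize {L' : FirstOrder.Language.{u, u}} {S : L'.Structure U}
    (hS : IsSatStr U S) {B : Set U} (hB : #B < #U) {m : ℕ} (q : Set (L'.Formula (Fin m ⊕ B)))
    (hq : ∀ s : Finset (L'.Formula (Fin m ⊕ B)), ↑s ⊆ q →
      ∃ d : Fin m → U, ∀ φ ∈ s, FRealize U S φ (Sum.elim d Subtype.val)) :
    ∃ d : Fin m → U, ∀ φ ∈ q, FRealize U S φ (Sum.elim d Subtype.val) := by
  classical
  obtain ⟨d, hd⟩ := hS B hB m ((fun φ => paramFormula φ id) '' q) (fun s hs => by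
    obtain ⟨t, htq, rfl⟩ := Finset.subset_set_image_iff.1 hs
    obtain ⟨d, hd⟩ := hq t htq
    refine ⟨d, fun ψ hψ => ?_⟩
    obtain ⟨φ, hφ, rfl⟩ := Finset.mem_image.1 hψ
    exact (realize_paramFormula φ id d).2 (hd φ hφ))
  exact ⟨d, fun φ hφ => (realize_paramFormula φ id d).1 (hd _ ⟨φ, hφ, rfl⟩)⟩

theorem exists_formula_fin {α : Type*} (φ : L.Formula α) :
    ∃ (k : ℕ) (φ₀ : L.Formula (Fin k)) (e : Fin k → α),
      ∀ v : α → U, φ.Realize v ↔ φ₀.Realize (v ∘ e) := by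
  classical
  refine ⟨φ.freeVarFinset.card, BoundedFormula.restrictFreeVar φ φ.freeVarFinset.equivFin,
    fun i => φ.freeVarFinset.equivFin.symm i, fun v => ?_⟩
  exact (BoundedFormula.realize_restrictFreeVar v (by simp)).symm

theorem exists_formula_sum_fin {α γ : Type*} (φ : L.Formula (α ⊕ γ)) :
    ∃ (k : ℕ) (φ₀ : L.Formula (α ⊕ Fin k)) (c : Fin k → γ),
      ∀ (d : α → U) (v : γ → U),
        φ.Realize (Sum.elim d v) ↔ φ₀.Realize (Sum.elim d (v ∘ c)) := by
  obtain ⟨l, φ₁, e, he⟩ := exists_formula_fin (U := U) φ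
  have hfin : {x : γ | ∃ i, e i = Sum.inr x}.Finite :=
    Set.Finite.preimage (s := Set.range e) Sum.inr_injective.injOn (Set.finite_range e)
  have := hfin.to_subtype
  obtain ⟨k, ⟨eqv⟩⟩ := Finite.exists_equiv_fin {x : γ | ∃ i, e i = Sum.inr x}
  have hg : ∀ i, ∃ y : α ⊕ Fin k, Sum.map id (fun j => (eqv.symm j : γ)) y = e i := by
    intro i
    rcases h : e i with a | x
    · exact ⟨Sum.inl a, rfl⟩
    · exact ⟨Sum.inr (eqv ⟨x, i, h⟩), by simp⟩
  choose g hg using hg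
  refine ⟨k, φ₁.relabel g, fun j => (eqv.symm j : γ), fun d v => ?_⟩
  rw [he, Formula.realize_relabel]
  refine iff_of_eq (congrArg _ (funext fun i => ?_))
  simp only [Function.comp_apply, ← hg i]
  rcases g i with a | x <;> rfl

end Parameters

section BackAndForth

variable {L U}

variable (L) in
/-- A set of pairs preserving all formulas. -/
def PartialElem (R : Set (U × U)) : Prop :=
  ∀ (k : ℕ) (φ : L.Formula (Fin k)) (v : Fin k → U × U), (∀ i, v i ∈ R) →
    (φ.Realize (fun i => (v i).1) ↔ φ.Realize (fun i => (v i).2))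

theorem elim_comp_swap {α β γ : Type*} (v : α → γ) (w : β → γ) :
    Sum.elim v w ∘ Sum.swap = Sum.elim w v := by
  ext (_ | _) <;> rfl

namespace PartialElem

theorem realize_iff {R : Set (U × U)} (hR : PartialElem L R) {α : Type*} (φ : L.Formula α)
    {v w : α → U} (hv : ∀ a, (v a, w a) ∈ R) : φ.Realize v ↔ φ.Realize w := by
  obtain ⟨k, φ₀, e, he⟩ := exists_formula_fin (U := U) φ
  rw [he, he]
  exact hR k φ₀ (fun i => (v (e i), w (e i))) fun i => hv _

theorem eq_iff {R : Set (U × U)} (hR : PartialElem L R) {x y x' y' : U} (h : (x, y) ∈ R)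
    (h' : (x', y') ∈ R) : x = x' ↔ y = y' := by
  have := hR.realize_iff (Term.equal (Term.var 0) (Term.var 1) : L.Formula (Fin 2))
    (v := ![x, x']) (w := ![y, y']) (by intro i; fin_cases i <;> assumption)
  simpa [Formula.realize_equal] using this

theorem swap {R : Set (U × U)} (hR : PartialElem L R) : PartialElem L (Prod.swap ⁻¹' R) :=
  fun k φ v hv => (hR k φ (fun i => (v i).swap) hv).symm

theorem sUnion {T : Set (Set (U × U))} (hne : T.Nonempty) (hdir : DirectedOn (· ⊆ ·) T)
    (hT : ∀ R ∈ T, PartialElem L R) : PartialElem L (⋃₀ T) := by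
  intro k φ v hv
  obtain ⟨R, hR, hvR⟩ := hdir.exists_mem_subset_of_finite_of_subset_sUnion hne
    (Set.finite_range v) (Set.range_subset_iff.2 hv)
  exact hT R hR k φ v (Set.range_subset_iff.1 hvR)

theorem exists_insert_snd (hsat : IsSatStr U iS) {R : Set (U × U)} (hR : PartialElem L R)
    (hcard : #R < #U) (c : U) : ∃ d, PartialElem L (insert (c, d) R) := by
  have hg : ∀ b : Prod.snd '' R, ∃ x, (x, (b : U)) ∈ R := by
    rintro ⟨_, ⟨x, y⟩, h, rfl⟩
    exact ⟨x, h⟩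
  choose g hg using hg
  obtain ⟨d, hd⟩ := hsat.exists_realize (mk_image_le.trans_lt hcard)
    {φ : L.Formula (Fin 1 ⊕ (Prod.snd '' R : Set U)) | φ.Realize (Sum.elim (fun _ => c) g)}
    (fun s hs => by
      have h1 : (Formula.iExs (Fin 1)
          ((Formula.iInf fun φ : s => (φ : L.Formula _)).relabel Sum.swap)).Realize g := by
        rw [Formula.realize_iExs]
        refine ⟨fun _ => c, ?_⟩
        rw [Formula.realize_relabel, Formula.realize_iInf, elim_comp_swap]
        exact fun φ => hs φ.2
      rw [hR.realize_iff _ (w := Subtype.val) hg, Formula.realize_iExs] at h1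
      obtain ⟨d, h1⟩ := h1
      rw [Formula.realize_relabel, Formula.realize_iInf, elim_comp_swap] at h1
      exact ⟨d, fun φ hφ => h1 ⟨φ, hφ⟩⟩)
  refine ⟨d 0, fun k φ v hv => ?_⟩
  have hh : ∀ i, ∃ y : Fin 1 ⊕ (Prod.snd '' R : Set U),
      (v i).1 = Sum.elim (fun _ => c) g y ∧ (v i).2 = Sum.elim d Subtype.val y := by
    intro i
    rcases hv i with h | h
    · exact ⟨Sum.inl 0, by rw [h]; exact ⟨rfl, rfl⟩⟩
    · exact ⟨Sum.inr ⟨(v i).2, v i, h, rfl⟩, (hR.eq_iff h (hg _)).2 rfl, rfl⟩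
  choose h h1 h2 using hh
  have key : ∀ φ : L.Formula (Fin k),
      φ.Realize (fun i => (v i).1) → φ.Realize (fun i => (v i).2) := by
    intro φ hφ
    have := hd (φ.relabel h) (by
      refine Formula.realize_relabel.2 ?_
      simpa only [h1] using! hφ)
    have := Formula.realize_relabel.1 this
    simpa only [h2] using! this
  exact ⟨key φ, fun hφ => by_contra fun hn => key φ.not hn hφ⟩

theorem exists_insert_fst (hsat : IsSatStr U iS) {R : Set (U × U)} (hR : PartialElem L R)
    (hcard : #R < #U) (d : U) : ∃ c, PartialElem L (insert (c, d) R) := by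
  have hcard' : #(Prod.swap ⁻¹' R) < #U := by
    exact (mk_preimage_of_injective Prod.swap R Prod.swap_injective).trans_lt hcard
  obtain ⟨c, hc⟩ := hR.swap.exists_insert_snd hsat hcard' d
  refine ⟨c, ?_⟩
  convert hc.swap using 1
  ext ⟨x, y⟩
  simp [and_comm]

/-- Saturated structures are strongly homogeneous. -/
theorem exists_equiv (hsat : IsSatStr U iS) (hinf : ℵ₀ ≤ #U) {R : Set (U × U)}
    (hR : PartialElem L R) (hcard : #R < #U) :
    ∃ f : U ≃[L] U, ∀ x y, (x, y) ∈ R → f x = y := by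
  classical
  obtain ⟨lo, wf, hord⟩ := exists_ord_eq_type_lt (U × Bool)
  have hW : #(U × Bool) = #U := by
    rw [mk_prod, mk_bool]
    simpa using Cardinal.mul_eq_left hinf (ofNat_lt_aleph0.le.trans hinf) two_ne_zero
  have hIio : ∀ w : U × Bool, #(Set.Iio w) < #U := fun w => hW ▸ mk_Iio_lt w hord
  let good (w : U × Bool) (T : Set (U × U)) (z : U × U) : Prop :=
    PartialElem L (insert z T) ∧ (w.2 = true → z.1 = w.1) ∧ (w.2 = false → z.2 = w.1)
  have hgood : ∀ w T, PartialElem L T → #T < #U → ∃ z, good w T z := by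
    rintro ⟨u, _ | _⟩ T hT hTc
    · obtain ⟨c, hc⟩ := hT.exists_insert_fst hsat hTc u
      exact ⟨(c, u), hc, by simp, by simp⟩
    · obtain ⟨d, hd⟩ := hT.exists_insert_snd hsat hTc u
      exact ⟨(u, d), hd, by simp, by simp⟩
  let step (w : U × Bool) (ih : ∀ v, v < w → U × U) : U × U :=
    Classical.epsilon (h := ⟨(w.1, w.1)⟩)
      (good w (R ∪ {z | ∃ v, ∃ h : v < w, ih v h = z}))
  let q : U × Bool → U × U := wf.wf.fix step
  have hq : ∀ w, q w = step w fun v _ => q v := fun w => wf.wf.fix_eq step w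
  have hset : ∀ w, {z | ∃ v, ∃ _ : v < w, q v = z} = q '' Set.Iio w := by
    intro w; ext z; simp
  have union_mem : ∀ s : Set (U × Bool),
      (∀ v ∈ s, PartialElem L (R ∪ q '' Set.Iic v)) → PartialElem L (R ∪ q '' s) := by
    intro s hs
    have hchain : IsChain (· ⊆ ·)
        (insert R ((fun v => R ∪ q '' Set.Iic v) '' s)) := by
      refine IsChain.insert ?_ ?_
      · rintro _ ⟨v, -, rfl⟩ _ ⟨v', -, rfl⟩ -
        rcases le_total v v' with h | h
        · exact Or.inl (Set.union_subset_union_right _ (Set.image_mono (Set.Iic_subset_Iic.2 h)))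
        · exact Or.inr (Set.union_subset_union_right _ (Set.image_mono (Set.Iic_subset_Iic.2 h)))
      · rintro _ ⟨v, -, rfl⟩ -
        exact Or.inl Set.subset_union_left
    have h := sUnion (L := L) (Set.insert_nonempty _ _) hchain.directedOn (by
      rintro _ (rfl | ⟨v, hv, rfl⟩)
      · exact hR
      · exact hs v hv)
    intro k φ v hv
    refine h k φ v fun i => ?_
    rcases hv i with hi | ⟨w, hw, hi⟩
    · exact ⟨R, Set.mem_insert _ _, hi⟩
    · exact ⟨_, Set.mem_insert_of_mem _ ⟨w, hw, rfl⟩, Or.inr ⟨w, le_rfl, hi⟩⟩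
  have hq_good : ∀ w, PartialElem L (R ∪ q '' Set.Iio w) →
      good w (R ∪ q '' Set.Iio w) (q w) := by
    intro w hw
    have hc : #(R ∪ q '' Set.Iio w : Set (U × U)) < #U :=
      (mk_union_le _ _).trans_lt (add_lt_of_lt hinf hcard (mk_image_le.trans_lt (hIio w)))
    rw [hq w]
    simp only [step, hset]
    exact Classical.epsilon_spec (hgood w _ hw hc)
  have hIic : ∀ w, PartialElem L (R ∪ q '' Set.Iic w) := by
    intro w
    induction w using wf.wf.induction with
    | _ w ih =>
      have h := (hq_good w (union_mem _ fun v hv => ih v hv)).1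
      rwa [← Set.Iio_insert, Set.image_insert_eq, Set.union_insert]
  have hqg : ∀ w, good w (R ∪ q '' Set.Iio w) (q w) := fun w =>
    hq_good w (union_mem _ fun v _ => hIic v)
  have hQ : PartialElem L (R ∪ q '' Set.univ) := union_mem _ fun v _ => hIic v
  set Q := R ∪ q '' Set.univ
  have hf : ∀ x, ∃ y, (x, y) ∈ Q := fun x =>
    ⟨(q (x, true)).2, Or.inr ⟨(x, true), trivial, Prod.ext ((hqg (x, true)).2.1 rfl) rfl⟩⟩
  have hf' : ∀ y, ∃ x, (x, y) ∈ Q := fun y =>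
    ⟨(q (y, false)).1, Or.inr ⟨(y, false), trivial, Prod.ext rfl ((hqg (y, false)).2.2 rfl)⟩⟩
  choose f hf using hf
  choose f' hf' using hf'
  refine ⟨{ toFun := f
            invFun := f'
            left_inv := fun x => (hQ.eq_iff (hf' (f x)) (hf x)).2 rfl
            right_inv := fun y => (hQ.eq_iff (hf (f' y)) (hf' y)).1 rfl
            map_fun' := fun {m} F x => ?_
            map_rel' := fun {m} r x => ?_ }, fun x y h => (hQ.eq_iff (hf x) (Or.inl h)).1 rfl⟩
  · have := hQ.realize_iff
      (Term.equal (Term.var (Sum.inr ())) (Term.func F fun i => Term.var (Sum.inl i)) :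
        L.Formula (Fin m ⊕ Unit))
      (v := Sum.elim x fun _ => Structure.funMap F x)
      (w := Sum.elim (f ∘ x) fun _ => f (Structure.funMap F x))
      (by rintro (i | i) <;> exact hf _)
    simpa [Formula.realize_equal] using! this
  · have := hQ.realize_iff (Relations.formula r fun i => Term.var i)
      (v := x) (w := f ∘ x) (fun i => hf _)
    simpa [Formula.realize_rel] using! this.symm

end PartialElem

end BackAndForth

section InvariantTypes

variable {L U}

theorem exists_autFix (hsat : IsSatStr U iS) (hinf : ℵ₀ ≤ #U) {A : Set U} (hA : #A < #U)
    {κ : Type} [Finite κ] (t t' : κ → U)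
    (h : ∀ φ : L.Formula (κ ⊕ A), φ.Realize (Sum.elim t Subtype.val) →
      φ.Realize (Sum.elim t' Subtype.val)) :
    ∃ f ∈ AutFix L U A, ∀ y, f (t y) = t' y := by
  let pr : κ ⊕ A → U × U := fun y => (Sum.elim t Subtype.val y, Sum.elim t' Subtype.val y)
  have hR : PartialElem L (Set.range pr) := by
    intro k φ v hv
    choose g hg using hv
    have key : ∀ φ : L.Formula (Fin k),
        φ.Realize (fun i => (v i).1) → φ.Realize (fun i => (v i).2) := by
      intro φ hφ
      simp only [← hg] at hφ ⊢
      have := h (φ.relabel g) (Formula.realize_relabel.2 hφ)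
      rwa [Formula.realize_relabel] at this
    exact ⟨key φ, fun hφ => by_contra fun hn => key φ.not hn hφ⟩
  have hcard : #(Set.range pr) < #U := by
    refine mk_range_le.trans_lt ?_
    rw [mk_sum]
    refine add_lt_of_lt hinf ?_ (by simpa using hA)
    exact (by simp : Cardinal.lift.{u} #κ < ℵ₀).trans_le hinf
  obtain ⟨f, hf⟩ := hR.exists_equiv hsat hinf hcard
  exact ⟨f, fun a ha => hf _ _ ⟨Sum.inr ⟨a, ha⟩, rfl⟩, fun y => hf _ _ ⟨Sum.inl y, rfl⟩⟩

/-- An `L`-formula as a formula of the expanded language. -/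
def baseFormula (n : ℕ) {α : Type*} (φ : L.Formula α) : (expLang L n).Formula α :=
  (LHom.sumInl : L →ᴸ L.sum (predLang n)).onFormula φ

theorem realize_baseFormula {n : ℕ} (C : Set (Fin n → U)) {α : Type*} (φ : L.Formula α)
    (w : α → U) : FRealize U (expStr L U C) (baseFormula n φ) w ↔ φ.Realize w :=
  @LHom.realize_onFormula _ _ U iS α (expStr L U C) LHom.sumInl
    (@LHom.IsExpansionOn.mk _ _ _ U iS (expStr L U C) (fun _ _ => rfl) fun _ _ => rfl) φ w

variable (L) in
/-- The formula expressing that a tuple of variables belongs to the new predicate. -/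
def predFormula {n : ℕ} {α : Type*} (v : Fin n → α) : (expLang L n).Formula α :=
  Relations.formula (Sum.inr ⟨⟨rfl⟩⟩ : (expLang L n).Relations n) fun j => Term.var (v j)

theorem realize_predFormula {n : ℕ} (C : Set (Fin n → U)) {α : Type*} (v : Fin n → α)
    (w : α → U) : FRealize U (expStr L U C) (predFormula L v) w ↔ w ∘ v ∈ C :=
  @Formula.realize_rel _ U (expStr L U C) _ _ _ _ _

theorem LACSat.exists_same_type {n : ℕ} {C : Set (Fin n → U)} {A M : Set U}
    (hM : LACSat L U C A M) {κ : Type} [Finite κ] (t : κ → U) :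
    ∃ t' : κ → U, (∀ y, t' y ∈ M) ∧ ∀ φ : (expLang L n).Formula (κ ⊕ A),
      FRealize U (expStr L U C) φ (Sum.elim t Subtype.val) →
        FRealize U (expStr L U C) φ (Sum.elim t' Subtype.val) := by
  obtain ⟨m, ⟨e⟩⟩ := Finite.exists_equiv_fin κ
  obtain ⟨b, hbM, hb⟩ := hM m
    {θ | FRealize U (addConsts U (expStr L U C) A) θ (t ∘ e.symm)}
    fun s hs => ⟨t ∘ e.symm, fun φ hφ => hs hφ⟩
  refine ⟨b ∘ e, fun y => hbM _, fun φ hφ => ?_⟩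
  let φ' : (expLang L n).Formula (Fin m ⊕ A) := φ.relabel (Sum.map e id)
  have hφ' : ∀ d : Fin m → U, FRealize U (addConsts U (expStr L U C) A) (paramFormula φ' id) d ↔
      FRealize U (expStr L U C) φ (Sum.elim (d ∘ e) Subtype.val) := by
    intro d
    rw [realize_paramFormula]
    let _ := expStr L U C
    refine (Formula.realize_relabel (M := U)).trans (iff_of_eq (congrArg _ ?_))
    ext (y | y) <;> rfl
  refine (hφ' b).1 (hb _ ((hφ' _).2 ?_))
  rwa [Function.comp_assoc, Equiv.symm_comp_self, Function.comp_id]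

theorem LACSat.subset {n : ℕ} {C : Set (Fin n → U)} {A M : Set U}
    (hM : LACSat L U C A M) : A ⊆ M := by
  intro a ha
  obtain ⟨t, htM, ht⟩ := hM.exists_same_type fun _ : Unit => a
  have := ht (baseFormula n (Term.equal (Term.var (Sum.inl ())) (Term.var (Sum.inr ⟨a, ha⟩))))
  simp only [realize_baseFormula, Formula.realize_equal] at this
  have h : t () = a := this rfl
  exact h ▸ htM ()

/-- The set `A` together with the coordinates of the first `i` tuples of `b`. -/
def initialParams {n : ℕ} (A : Set U) (b : ℕ → Fin n → U) (i : ℕ) : Set U :=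
  A ∪ {x | ∃ i' < i, ∃ j, b i' j = x}

theorem mk_initialParams_lt (hinf : ℵ₀ ≤ #U) {n : ℕ} {A : Set U} (hA : #A < #U)
    (b : ℕ → Fin n → U) (i : ℕ) : #(initialParams A b i) < #U := by
  refine (mk_union_le _ _).trans_lt (add_lt_of_lt hinf hA (lt_of_lt_of_le ?_ hinf))
  refine Set.Finite.lt_aleph0 (((Set.finite_Iio i).biUnion fun i' _ =>
    Set.finite_range (b i')).subset ?_)
  rintro x ⟨i', hi', j, rfl⟩
  exact Set.mem_biUnion hi' ⟨j, rfl⟩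

variable (L) in
/-- The first `k` tuples of `b` form a Morley sequence over `A` of the filter `F` of definable
sets, and they belong alternately to `C` and to its complement. -/
def AlternatingMorley {n : ℕ} (F : Filter (Fin n → U)) (A : Set U) (C : Set (Fin n → U))
    (b : ℕ → Fin n → U) (k : ℕ) : Prop :=
  ∀ i < k, (b i ∈ C ↔ Even i) ∧ ∀ (l : ℕ) (φ : L.Formula (Fin n ⊕ Fin l)) (c : Fin l → U),
    (∀ t, c t ∈ initialParams A b i) → (∀ᶠ d in F, φ.Realize (Sum.elim d c)) →
      φ.Realize (Sum.elim (b i) c)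

section

variable {n : ℕ} {F : Filter (Fin n → U)} {A : Set U} {C : Set (Fin n → U)}

theorem AlternatingMorley.exists_autFix (hsat : IsSatStr U iS) (hinf : ℵ₀ ≤ #U) (hA : #A < #U)
    (hdec : ∀ (k : ℕ) (φ : L.Formula (Fin n ⊕ Fin k)) (c : Fin k → U),
      (∀ᶠ d in F, φ.Realize (Sum.elim d c)) ∨ ∀ᶠ d in F, ¬φ.Realize (Sum.elim d c))
    (hinv : ∀ (k : ℕ) (φ : L.Formula (Fin n ⊕ Fin k)) (c : Fin k → U), ∀ f ∈ AutFix L U A,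
      (∀ᶠ d in F, φ.Realize (Sum.elim d c)) → ∀ᶠ d in F, φ.Realize (Sum.elim d (f ∘ c)))
    {b : ℕ → Fin n → U} {K : ℕ} (hb : AlternatingMorley L F A C b K) {σ : ℕ → ℕ}
    (hσ : StrictMono σ) (N : ℕ) (hN : ∀ i < N, σ i < K) :
    ∃ f ∈ AutFix L U A, ∀ i < N, ∀ j, f (b i j) = b (σ i) j := by
  induction N with
  | zero => exact ⟨FirstOrder.Language.Equiv.refl L U, fun _ _ => rfl, by simp⟩
  | succ N ih =>
    obtain ⟨f, hfA, hf⟩ := ih fun i hi => hN i (by omega)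
    have hσN := hN N (by omega)
    have hg : ∀ y : (Fin (N + 1) × Fin n) ⊕ A, ∃ z : Fin n ⊕ initialParams A b N,
        Sum.elim (b N) Subtype.val z = Sum.elim (fun y => b y.1 y.2) Subtype.val y ∧
        Sum.elim (b (σ N)) (f ∘ Subtype.val) z =
          Sum.elim (fun y => b (σ y.1) y.2) Subtype.val y := by
      rintro (⟨i, j⟩ | a)
      · rcases Nat.lt_succ_iff_lt_or_eq.1 i.2 with hi | hi
        · exact ⟨Sum.inr ⟨b i j, Or.inr ⟨i, hi, j, rfl⟩⟩, rfl, hf i hi j⟩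
        · exact ⟨Sum.inl j, by simp [hi], by simp [hi]⟩
      · exact ⟨Sum.inr ⟨a, Or.inl a.2⟩, rfl, hfA a a.2⟩
    choose g hg₁ hg₂ using hg
    obtain ⟨f', hf'A, hf'⟩ := Paper.exists_autFix hsat hinf hA
      (fun y : Fin (N + 1) × Fin n => b y.1 y.2) (fun y => b (σ y.1) y.2) (fun φ hφ => by
        obtain ⟨l, φ₀, c, hc⟩ := exists_formula_sum_fin (U := U) (φ.relabel g)
        have both : ∀ θ : L.Formula (Fin n ⊕ Fin l),
            (∀ᶠ d in F, θ.Realize (Sum.elim d (Subtype.val ∘ c))) →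
            θ.Realize (Sum.elim (b N) (Subtype.val ∘ c)) ∧
            θ.Realize (Sum.elim (b (σ N)) (f ∘ Subtype.val ∘ c)) := by
          intro θ hθ
          refine ⟨(hb N ((hσ.id_le N).trans_lt hσN)).2 l θ _ (fun t => (c t).2) hθ,
            (hb (σ N) hσN).2 l θ _ (fun t => ?_) (hinv l θ _ f hfA hθ)⟩
          rcases h : c t with ⟨x, hx | ⟨i, hi, j, rfl⟩⟩
          · exact Or.inl (by simpa [h, hfA x hx] using hx)
          · exact Or.inr ⟨σ i, hσ hi, j, by simp [h, hf i hi j]⟩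
        have e₁ := hc (b N) Subtype.val
        have e₂ := hc (b (σ N)) (f ∘ Subtype.val)
        rw [Formula.realize_relabel] at e₁ e₂
        rw [show Sum.elim (b N) Subtype.val ∘ g = _ from funext hg₁] at e₁
        rw [show Sum.elim (b (σ N)) (f ∘ Subtype.val) ∘ g = _ from funext hg₂] at e₂
        rw [e₁] at hφ
        rw [e₂]
        rcases hdec l φ₀ (Subtype.val ∘ c) with h | h
        · exact (both φ₀ h).2
        · exact absurd hφ (both φ₀.not h).1)
    exact ⟨f', hf'A, fun i hi j => hf' (⟨i, hi⟩, j)⟩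

theorem AlternatingMorley.not_finiteVC (hsat : IsSatStr U iS) (hinf : ℵ₀ ≤ #U) (hA : #A < #U)
    (hdec : ∀ (k : ℕ) (φ : L.Formula (Fin n ⊕ Fin k)) (c : Fin k → U),
      (∀ᶠ d in F, φ.Realize (Sum.elim d c)) ∨ ∀ᶠ d in F, ¬φ.Realize (Sum.elim d c))
    (hinv : ∀ (k : ℕ) (φ : L.Formula (Fin n ⊕ Fin k)) (c : Fin k → U), ∀ f ∈ AutFix L U A,
      (∀ᶠ d in F, φ.Realize (Sum.elim d c)) → ∀ᶠ d in F, φ.Realize (Sum.elim d (f ∘ c)))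
    (hb : ∀ k, ∃ b, AlternatingMorley L F A C b k) : ¬FiniteVC (oSet L U A C) := by
  classical
  rintro ⟨N, hN⟩
  obtain ⟨b, hb⟩ := hb (2 * N)
  have pattern : ∀ τ : ℕ → Prop, ∃ f ∈ AutFix L U A, ∀ i < N, ⇑f ∘ b i ∈ C ↔ τ i := by
    intro τ
    let σ : ℕ → ℕ := fun i => if τ i then 2 * i else 2 * i + 1
    have hσ : StrictMono σ := strictMono_nat_of_lt_succ fun i => by
      simp only [σ]; split_ifs <;> omega
    have hσK : ∀ i < N, σ i < 2 * N := fun i hi => by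
      simp only [σ]; split_ifs <;> omega
    obtain ⟨f, hfA, hf⟩ := hb.exists_autFix hsat hinf hA hdec hinv hσ N hσK
    refine ⟨f, hfA, fun i hi => ?_⟩
    rw [show ⇑f ∘ b i = b (σ i) from funext (hf i hi), (hb _ (hσK i hi)).1]
    by_cases h : τ i <;> simp [σ, h]
  have hinj : Set.InjOn b (Finset.range N : Finset ℕ) := by
    intro i hi j hj hij
    obtain ⟨f, -, hf⟩ := pattern (· = i)
    have hi' := (hf i (by simpa using hi)).2 rfl
    exact ((hf j (by simpa using hj)).1 (hij ▸ hi')).symm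
  refine hN ((Finset.range N).image b) (by rw [Finset.card_image_of_injOn hinj, Finset.card_range])
    fun H hH => ?_
  obtain ⟨f, hfA, hf⟩ := pattern (fun i => b i ∈ H)
  refine ⟨imgSet L U f.symm C, ⟨f.symm, fun a ha => ?_, rfl⟩, ?_⟩
  · conv_lhs => rw [← hfA a ha]
    exact f.symm_apply_apply a
  · have himg : ∀ x : Fin n → U, x ∈ imgSet L U f.symm C ↔ ⇑f ∘ x ∈ C := by
      intro x
      constructor
      · rintro ⟨y, hy, rfl⟩
        convert hy
        ext j
        exact f.apply_symm_apply _
      · exact fun hx => ⟨_, hx, funext fun j => f.symm_apply_apply _⟩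
    ext x
    constructor
    · rintro ⟨hx, hxB⟩
      obtain ⟨i, hi, rfl⟩ := Finset.mem_image.1 (Finset.mem_coe.1 hxB)
      exact (hf i (Finset.mem_range.1 hi)).1 ((himg _).1 hx)
    · intro hx
      obtain ⟨i, hi, rfl⟩ := Finset.mem_image.1 (Finset.mem_coe.1 (hH hx))
      exact ⟨(himg _).2 ((hf i (Finset.mem_range.1 hi)).2 hx), hH hx⟩

theorem exists_realize_alternate (hCsat : SatSet L U C) {B M : Set U}
    (hB : #B < #U) (hBM : B ⊆ M)
    (hM : ∀ (k : ℕ) (φ : L.Formula (Fin n ⊕ Fin k)) (c : Fin k → U), (∀ i, c i ∈ M) →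
      (∀ᶠ d in F, φ.Realize (Sum.elim d c)) →
        ∀ P : Prop, ∃ d, (d ∈ C ↔ P) ∧ φ.Realize (Sum.elim d c)) (P : Prop) :
    ∃ d : Fin n → U, (d ∈ C ↔ P) ∧ ∀ (l : ℕ) (φ : L.Formula (Fin n ⊕ Fin l)) (c : Fin l → U),
      (∀ t, c t ∈ B) → (∀ᶠ d in F, φ.Realize (Sum.elim d c)) → φ.Realize (Sum.elim d c) := by
  classical
  let χ₀ : (expLang L n).Formula (Fin n ⊕ B) := predFormula L Sum.inl
  let χ := if P then χ₀ else χ₀.not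
  have hχ : ∀ d : Fin n → U,
      FRealize U (expStr L U C) χ (Sum.elim d Subtype.val) ↔ (d ∈ C ↔ P) := by
    intro d
    have h₀ := realize_predFormula (L := L) C (Sum.inl : Fin n → Fin n ⊕ B)
      (Sum.elim d Subtype.val)
    rw [Sum.elim_comp_inl] at h₀
    by_cases hP : P
    · simpa [χ, hP] using h₀
    · simp only [χ, hP, if_false, iff_false]
      exact not_congr h₀
  let q : Set ((expLang L n).Formula (Fin n ⊕ B)) :=
    insert χ (baseFormula n '' {θ | ∀ᶠ d in F, θ.Realize (Sum.elim d Subtype.val)})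
  obtain ⟨d, hd⟩ := IsSatStr.exists_realize hCsat hB q (fun s hs => by
    have hθ : ∃ θ : L.Formula (Fin n ⊕ B), (∀ᶠ d in F, θ.Realize (Sum.elim d Subtype.val)) ∧
        ∀ d, θ.Realize (Sum.elim d Subtype.val) → ∀ φ ∈ s, φ = χ ∨
          FRealize U (expStr L U C) φ (Sum.elim d Subtype.val) := by
      induction s using Finset.induction with
      | empty => exact ⟨⊤, by simp, by simp⟩
      | insert φ s _ ih =>
        rw [Finset.coe_insert, Set.insert_subset_iff] at hs
        obtain ⟨θ, hθF, hθ⟩ := ih hs.2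
        rcases hs.1 with rfl | ⟨ρ, hρ, rfl⟩
        · refine ⟨θ, hθF, fun d hd φ hφ => ?_⟩
          rcases Finset.mem_insert.1 hφ with rfl | hφ
          · exact Or.inl rfl
          · exact hθ d hd φ hφ
        · refine ⟨θ ⊓ ρ, ?_, fun d hd φ hφ => ?_⟩
          · filter_upwards [hθF, hρ] with d h₁ h₂
            exact Formula.realize_inf.2 ⟨h₁, h₂⟩
          · rw [Formula.realize_inf] at hd
            rcases Finset.mem_insert.1 hφ with rfl | hφ
            · exact Or.inr ((realize_baseFormula C ρ _).2 hd.2)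
            · exact hθ d hd.1 φ hφ
    obtain ⟨θ, hθF, hθ⟩ := hθ
    obtain ⟨k, θ₀, c, hc⟩ := exists_formula_sum_fin (U := U) θ
    simp only [hc] at hθF hθ
    obtain ⟨d, hdC, hd⟩ := hM k θ₀ _ (fun i => hBM (c i).2) hθF P
    refine ⟨d, fun φ hφ => ?_⟩
    rcases hθ d hd φ hφ with rfl | h
    · exact (hχ d).2 hdC
    · exact h)
  refine ⟨d, (hχ d).1 (hd χ (Set.mem_insert _ _)), fun l φ c hc hφ => ?_⟩
  let c' : Fin l → B := fun t => ⟨c t, hc t⟩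
  have hrel : ∀ d : Fin n → U, (φ.relabel (Sum.map id c')).Realize (Sum.elim d Subtype.val) ↔
      φ.Realize (Sum.elim d c) := by
    intro d
    rw [Formula.realize_relabel]
    refine iff_of_eq (congrArg _ ?_)
    ext (j | j) <;> rfl
  refine (hrel d).1 ((realize_baseFormula C _ _).1
    (hd _ (Set.mem_insert_of_mem _ ⟨φ.relabel (Sum.map id c'), ?_, rfl⟩)))
  exact hφ.mono fun d => (hrel d).2

theorem exists_alternatingMorley (hsat : IsSatStr U iS) (hinf : ℵ₀ ≤ #U) (hA : #A < #U)
    (hCsat : SatSet L U C) {M : Set U} (hMsat : LACSat L U C A M)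
    (hinv : ∀ (k : ℕ) (φ : L.Formula (Fin n ⊕ Fin k)) (c : Fin k → U), ∀ f ∈ AutFix L U A,
      (∀ᶠ d in F, φ.Realize (Sum.elim d c)) → ∀ᶠ d in F, φ.Realize (Sum.elim d (f ∘ c)))
    (hM : ∀ (k : ℕ) (φ : L.Formula (Fin n ⊕ Fin k)) (c : Fin k → U), (∀ i, c i ∈ M) →
      (∀ᶠ d in F, φ.Realize (Sum.elim d c)) →
        ∀ P : Prop, ∃ d, (d ∈ C ↔ P) ∧ φ.Realize (Sum.elim d c)) (k : ℕ) :
    ∃ b, AlternatingMorley L F A C b k ∧ ∀ i < k, ∀ j, b i j ∈ M := by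
  induction k with
  | zero =>
    have : Nonempty U := mk_ne_zero_iff.1 (aleph0_pos.trans_le hinf).ne'
    exact ⟨fun _ _ => Classical.arbitrary U, by simp [AlternatingMorley], by simp⟩
  | succ k ih =>
    obtain ⟨b, hb, hbM⟩ := ih
    obtain ⟨d, hdC, hd⟩ := exists_realize_alternate (B := initialParams A b k) hCsat
      (mk_initialParams_lt hinf hA b k) (by
        rintro x (hx | ⟨i, hi, j, rfl⟩)
        · exact hMsat.subset hx
        · exact hbM i hi j) hM (Even k)
    let a : ℕ → Fin n → U := fun i => if i < k then b i else d
    have ha : ∀ i < k, a i = b i := fun i hi => if_pos hi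
    have hak : a k = d := if_neg (lt_irrefl k)
    have hparams : ∀ i ≤ k, initialParams A a i = initialParams A b i := by
      intro i hi
      ext x
      refine or_congr Iff.rfl (exists_congr fun i' => and_congr_right fun hi' => ?_)
      rw [ha i' (hi'.trans_le hi)]
    have haM : AlternatingMorley L F A C a (k + 1) := by
      intro i hi
      rw [hparams i (Nat.lt_succ_iff.1 hi)]
      rcases Nat.lt_succ_iff_lt_or_eq.1 hi with hi | rfl
      · rw [ha i hi]
        exact hb i hi
      · rw [hak]
        exact ⟨hdC, hd⟩
    obtain ⟨t, htM, ht⟩ := hMsat.exists_same_type fun y : Fin (k + 1) × Fin n => a y.1 y.2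
    obtain ⟨f, hfA, hf⟩ := exists_autFix hsat hinf hA (fun y : Fin (k + 1) × Fin n => a y.1 y.2) t
      fun φ hφ => (realize_baseFormula C φ _).1 (ht _ ((realize_baseFormula C φ _).2 hφ))
    refine ⟨fun i => ⇑f ∘ a i, fun i hi => ⟨?_, fun l φ c hc hφ => ?_⟩, fun i hi j => ?_⟩
    · let χ : (expLang L n).Formula ((Fin (k + 1) × Fin n) ⊕ A) :=
        predFormula L fun j => Sum.inl (⟨i, hi⟩, j)
      have h₁ := realize_predFormula (L := L) C
        (fun j => (Sum.inl (⟨i, hi⟩, j) : (Fin (k + 1) × Fin n) ⊕ A))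
      have h₂ : ⇑f ∘ a i = fun j => t (⟨i, hi⟩, j) := funext fun j => hf (⟨i, hi⟩, j)
      rw [← (haM i hi).1]
      change ⇑f ∘ a i ∈ C ↔ a i ∈ C
      rw [h₂]
      constructor
      · exact fun h => by_contra fun hn => ht χ.not (fun h' => hn ((h₁ _).1 h')) ((h₁ _).2 h)
      · exact fun h => (h₁ _).1 (ht χ ((h₁ _).2 h))
    · have hfc : ⇑f ∘ ⇑f.symm ∘ c = c := funext fun t => f.apply_symm_apply _
      have hsymm : f.symm ∈ AutFix L U A := fun x hx => by
        conv_lhs => rw [← hfA x hx]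
        exact f.symm_apply_apply x
      have := (haM i hi).2 l φ (⇑f.symm ∘ c) (fun t => ?_) (hinv l φ c _ hsymm hφ)
      · rw [← StrongHomClass.realize_formula f φ, Sum.comp_elim, hfc] at this
        exact this
      · rcases hc t with h | ⟨i', hi', j, h⟩
        · exact Or.inl (by simpa [hsymm _ h] using h)
        · exact Or.inr ⟨i', hi', j, by simp [← h]⟩
    · change f (a i j) ∈ M
      rw [hf (⟨i, hi⟩, j)]
      exact htM _

end

namespace IsGlobalType

variable {n : ℕ} {p : Set ((L[[U]]).Formula (Fin n))}

theorem mem_of_forall (hp : IsGlobalType L U p) {s : Finset ((L[[U]]).Formula (Fin n))}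
    (hs : ↑s ⊆ p) {ψ : (L[[U]]).Formula (Fin n)}
    (h : ∀ d, (∀ φ ∈ s, FRealize U (addAllConsts U iS) φ d) →
      FRealize U (addAllConsts U iS) ψ d) : ψ ∈ p := by
  classical
  by_contra hψ
  have hn : ψ.not ∈ p := by
    by_contra hn
    exact hψ ((hp.2 ψ).2 hn)
  obtain ⟨d, hd⟩ := hp.1 (insert ψ.not s) (by
    rw [Finset.coe_insert]
    exact Set.insert_subset hn hs)
  exact hd ψ.not (Finset.mem_insert_self _ _)
    (h d fun φ hφ => hd φ (Finset.mem_insert_of_mem hφ))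

/-- The filter generated by the sets defined by the formulas of a global type. -/
def filter (hp : IsGlobalType L U p) : Filter (Fin n → U) where
  sets := {X | ∃ ψ ∈ p, ∀ d, FRealize U (addAllConsts U iS) ψ d → d ∈ X}
  univ_sets := ⟨⊤, hp.mem_of_forall (s := ∅) (by simp) fun _ _ => id, fun _ _ => trivial⟩
  sets_of_superset := fun ⟨ψ, hψ, h⟩ hXY => ⟨ψ, hψ, fun d hd => hXY (h d hd)⟩
  inter_sets := by
    classical
    rintro X Y ⟨ψ, hψ, h⟩ ⟨ρ, hρ, h'⟩
    have hinf : ∀ d, FRealize U (addAllConsts U iS) (ψ ⊓ ρ) d ↔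
        FRealize U (addAllConsts U iS) ψ d ∧ FRealize U (addAllConsts U iS) ρ d := fun d =>
      @Formula.realize_inf _ U (addAllConsts U iS) _ _ _ _
    refine ⟨ψ ⊓ ρ, hp.mem_of_forall (s := {ψ, ρ}) ?_ fun d hd => ?_, fun d hd => ?_⟩
    · simp [Set.insert_subset_iff, hψ, hρ]
    · exact (hinf d).2 ⟨hd ψ (by simp), hd ρ (by simp)⟩
    · exact ⟨h d ((hinf d).1 hd).1, h' d ((hinf d).1 hd).2⟩

theorem mem_iff_eventually (hp : IsGlobalType L U p) (ψ : (L[[U]]).Formula (Fin n)) :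
    ψ ∈ p ↔ ∀ᶠ d in hp.filter, FRealize U (addAllConsts U iS) ψ d := by
  constructor
  · exact fun h => ⟨ψ, h, fun d hd => hd⟩
  · rintro ⟨ρ, hρ, h⟩
    exact hp.mem_of_forall (s := {ρ}) (by simpa using hρ) fun d hd => h d (hd ρ (by simp))

theorem instFormula_mem_iff (hp : IsGlobalType L U p) {k : ℕ} (φ : L.Formula (Fin n ⊕ Fin k))
    (c : Fin k → U) :
    instFormula L U φ c ∈ p ↔ ∀ᶠ d in hp.filter, φ.Realize (Sum.elim d c) := by
  rw [hp.mem_iff_eventually]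
  exact Filter.eventually_congr (Filter.Eventually.of_forall fun d => realize_paramFormula_all φ c d)

end IsGlobalType

end InvariantTypes

/-- if `C` is saturated, `o(C/A)` has finite VC dimension and `M ⪯ U` is
`L(A;C)`-saturated, then every global `A`-invariant type contains a formula `ψ(z)` over `M`
with `ψ(U) ⊆ C` or `ψ(U) ⊆ ¬C`. -/
theorem stmt6 (L : FirstOrder.Language.{u, u}) (U : Type u) [iS : L.Structure U]
    (hsat : IsSatStr U iS) (hinacc : Cardinal.IsInaccessible #U) (hcard : L.card < #U)
    (n : ℕ) (C : Set (Fin n → U)) (A : Set U) (hA : #A < #U)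
    (hCsat : SatSet L U C) (hvc : FiniteVC (oSet L U A C))
    (M : L.ElementarySubstructure U) (hMsat : LACSat L U C A (M : Set U))
    (p : Set ((L[[U]]).Formula (Fin n)))
    (hp : IsGlobalType L U p) (hinv : GlobalTypeInv L U A p) :
    ∃ ψ : (L[[↥(M : Set U)]]).Formula (Fin n),
      (liftConsts L U (M : Set U)).onFormula ψ ∈ p ∧
      ({a : Fin n → U | FRealize U (addConsts U iS (M : Set U)) ψ a} ⊆ C ∨
        {a : Fin n → U | FRealize U (addConsts U iS (M : Set U)) ψ a} ⊆ Cᶜ) := by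
  have hinf : ℵ₀ ≤ #U := hinacc.aleph0_lt.le
  by_contra hno
  push Not at hno
  have hdec : ∀ (k : ℕ) (φ : L.Formula (Fin n ⊕ Fin k)) (c : Fin k → U),
      (∀ᶠ d in hp.filter, φ.Realize (Sum.elim d c)) ∨
        ∀ᶠ d in hp.filter, ¬φ.Realize (Sum.elim d c) := by
    intro k φ c
    by_cases h : instFormula L U φ c ∈ p
    · exact Or.inl ((hp.instFormula_mem_iff φ c).1 h)
    · refine Or.inr ((hp.instFormula_mem_iff φ.not c).1 ?_)
      by_contra hn
      exact h ((hp.2 _).2 hn)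
  have hinv' : ∀ (k : ℕ) (φ : L.Formula (Fin n ⊕ Fin k)) (c : Fin k → U), ∀ f ∈ AutFix L U A,
      (∀ᶠ d in hp.filter, φ.Realize (Sum.elim d c)) →
        ∀ᶠ d in hp.filter, φ.Realize (Sum.elim d (f ∘ c)) := by
    intro k φ c f hf h
    rw [← hp.instFormula_mem_iff] at h ⊢
    have hmem : ⇑f ∘ c ∈ imgSet L U f {a | instFormula L U φ a ∈ p} := ⟨c, h, rfl⟩
    rw [hinv k φ f hf] at hmem
    exact hmem
  have hM : ∀ (k : ℕ) (φ : L.Formula (Fin n ⊕ Fin k)) (c : Fin k → U), (∀ i, c i ∈ (M : Set U)) →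
      (∀ᶠ d in hp.filter, φ.Realize (Sum.elim d c)) →
        ∀ P : Prop, ∃ d, (d ∈ C ↔ P) ∧ φ.Realize (Sum.elim d c) := by
    intro k φ c hc h P
    let ψ : (L[[↥(M : Set U)]]).Formula (Fin n) := paramFormula φ fun i => ⟨c i, hc i⟩
    have hψ : ∀ d, FRealize U (addConsts U iS (M : Set U)) ψ d ↔ φ.Realize (Sum.elim d c) :=
      fun d => realize_paramFormula φ _ d
    obtain ⟨h₁, h₂⟩ := hno ψ ((hp.mem_iff_eventually _).2
      (h.mono fun d hd => (realize_liftConsts _ ψ d).2 ((hψ d).2 hd)))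
    by_cases hP : P
    · obtain ⟨d, hd, hdC⟩ := Set.not_subset.1 h₂
      exact ⟨d, iff_of_true (not_not.1 hdC) hP, (hψ d).1 hd⟩
    · obtain ⟨d, hd, hdC⟩ := Set.not_subset.1 h₁
      exact ⟨d, iff_of_false hdC hP, (hψ d).1 hd⟩
  refine AlternatingMorley.not_finiteVC hsat hinf hA hdec hinv' (fun k => ?_) hvc
  exact (exists_alternatingMorley hsat hinf hA hCsat hMsat hinv' hM k).imp fun _ h => h.1

end Paper
end
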